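/- Let A be a finite unital C*-algebra. Then A is a Rickart C*-algebra if and only if: for every x ∈ A and every inner ideal J ⊆ A which is orthogonal to the inner ideal A(x) generated by x, there exists a partial isometry e ∈ A such that J ⊆ A₂(e) and A(x) ⊆ A₀(e). -/

import Mathlib

/-- A projection in a C*-algebra: a self-adjoint idempotent. -/
def IsProjection {A : Type*} [Mul A] [Star A] (p : A) : Prop :=
  star p = p ∧ p * p = p

/-- A partial isometry: an element `e` such that `e * e*` is a projection. -/
def IsPartialIsometry {A : Type*} [Mul A] [Star A] (e : A) : Prop :=
  IsProjection (e * star e)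

/-- A unital C*-algebra is finite if every projection Murray–von Neumann equivalent
to the unit equals the unit. -/
def IsFiniteCStar (A : Type*) [CStarAlgebra A] : Prop :=
  ∀ p : A, IsProjection p → (∃ e : A, e * star e = p ∧ star e * e = 1) → p = 1

/-- A C*-algebra is Rickart if the right annihilator of every singleton is of the
form `p A` for a projection `p`. -/
def IsRickart (A : Type*) [CStarAlgebra A] : Prop :=
  ∀ x : A, ∃ p : A, IsProjection p ∧
    {y : A | x * y = 0} = {z : A | ∃ a : A, z = p * a}

/-- The Peirce-2 subspace associated with a partial isometry `e`. -/
def Peirce2 {A : Type*} [Mul A] [Star A] (e : A) : Set A :=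
  {z : A | e * star e * z * (star e * e) = z}

/-- The Peirce-0 subspace associated with a partial isometry `e`. -/
def Peirce0 {A : Type*} [Mul A] [Star A] [Zero A] (e : A) : Set A :=
  {z : A | e * star e * z = 0 ∧ z * (star e * e) = 0}

/-- Orthogonality of elements in a C*-algebra: `a ⊥ b` iff `a b* = 0` and `b* a = 0`. -/
def Orthog {A : Type*} [Mul A] [Star A] [Zero A] (a b : A) : Prop :=
  a * star b = 0 ∧ star b * a = 0

/-- A linear subspace `J` is an inner ideal if `x a y ∈ J` for all `x, y ∈ J`, `a ∈ A`. -/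
def IsInnerIdeal {A : Type*} [CStarAlgebra A] (J : Submodule ℂ A) : Prop :=
  ∀ x ∈ J, ∀ y ∈ J, ∀ a : A, x * a * y ∈ J

/-- The inner ideal of `A` generated by `x`: the norm closure of `x A x`. -/
def innerIdealGen {A : Type*} [CStarAlgebra A] (x : A) : Set A :=
  closure {z : A | ∃ a : A, z = x * a * x}

section Semigroup

variable {M : Type*} [Semigroup M]

theorem mul_mul_eq_of_mul_eq {a b c : M} (h : a * b = c) (z : M) : a * (b * z) = c * z := by
  rw [← mul_assoc, h]

theorem mul_mul_mul_eq_of_mul_mul_eq {a b c d : M} (h : a * (b * c) = d) (z : M) :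
    a * (b * (c * z)) = d * z := by
  rw [← h, mul_assoc, mul_assoc]

end Semigroup

section Projection

variable {R : Type*} [Ring R] [StarRing R] {p q : R}

theorem IsProjection.one_sub (hp : IsProjection p) : IsProjection (1 - p) :=
  ⟨by simp [hp.1], by simp [mul_sub, sub_mul, hp.2]⟩

theorem IsProjection.sub (hp : IsProjection p) (hq : IsProjection q) (h : p * q = q) :
    IsProjection (p - q) := by
  have hqp : q * p = q := by simpa [hp.1, hq.1] using congrArg star h
  exact ⟨by simp [hp.1, hq.1], by simp [mul_sub, sub_mul, hp.2, hq.2, h, hqp]⟩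

/-- Two projections with the same left annihilator are equal. -/
theorem IsProjection.eq_of_mul_eq_zero_iff (hp : IsProjection p) (hq : IsProjection q)
    (h : ∀ z, z * p = 0 ↔ z * q = 0) : p = q := by
  have h1 : (1 - p) * q = 0 := (h _).1 (by simp [sub_mul, hp.2])
  have h2 : (1 - q) * p = 0 := (h _).2 (by simp [sub_mul, hq.2])
  rw [sub_mul, one_mul, sub_eq_zero] at h1 h2
  have h3 := congrArg star h1
  rw [star_mul, hp.1, hq.1] at h3
  exact h2.trans h3.symm

theorem mul_eq_zero_comm_of_star {a b : R} (ha : star a = a) (hb : star b = b) (h : a * b = 0) :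
    b * a = 0 := by
  simpa [ha, hb] using congrArg star h

end Projection

section CStar

variable {A : Type*} [CStarAlgebra A]

theorem eq_zero_of_star_mul_self {a : A} (h : star a * a = 0) : a = 0 :=
  (CStarRing.star_mul_self_eq_zero_iff a).1 h

theorem mul_self_star_eq_zero_iff {z a : A} : z * (a * star a) = 0 ↔ z * a = 0 := by
  refine ⟨fun h => ?_, fun h => by rw [← mul_assoc, h, zero_mul]⟩
  refine (CStarRing.mul_star_self_eq_zero_iff _).1 ?_
  rw [star_mul, mul_assoc, ← mul_assoc a, ← mul_assoc, h, zero_mul]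

theorem mul_eq_self_of_star_mul_self {v p : A} (hp : p * p = p) (h : star v * v = p) :
    v * p = v := by
  have hs : star p = p := by rw [← h]; simp
  have : star (v * p - v) * (v * p - v) = 0 := by
    simp only [star_sub, star_mul, hs, sub_mul, mul_sub, mul_assoc]
    rw [← mul_assoc (star v) v, h]
    simp [hp]
  exact sub_eq_zero.1 (eq_zero_of_star_mul_self this)

theorem star_mul_mul_star_self {v : A} (h : v * (star v * v) = v) :
    star v * (v * star v) = star v := by
  simpa [mul_assoc] using congrArg star h

theorem isProjection_star_mul_self {v : A} (h : v * (star v * v) = v) :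
    IsProjection (star v * v) :=
  ⟨by simp, by rw [mul_assoc, h]⟩

theorem isProjection_mul_star_self {v : A} (h : v * (star v * v) = v) :
    IsProjection (v * star v) := by
  simpa using isProjection_star_mul_self (v := star v) (by simpa using star_mul_mul_star_self h)

/-- In a Rickart C*-algebra every element has a left projection. -/
theorem IsRickart.exists_leftProjection (hR : IsRickart A) (a : A) :
    ∃ p : A, IsProjection p ∧ ∀ z, z * a = 0 ↔ z * p = 0 := by
  obtain ⟨q, hq, h⟩ := hR (star a)
  refine ⟨1 - q, hq.one_sub, fun z => ?_⟩
  have h1 : z * a = 0 ↔ star a * star z = 0 := by rw [← star_mul, star_eq_zero]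
  have h2 : star a * star z = 0 ↔ ∃ b, star z = q * b := Set.ext_iff.1 h (star z)
  rw [h1, h2]
  constructor
  · rintro ⟨b, hb⟩
    have : z = star b * q := by simpa [hq.1] using congrArg star hb
    rw [this, mul_assoc, mul_sub, hq.2]
    simp
  · intro hz
    refine ⟨star z, ?_⟩
    rw [mul_sub, mul_one, sub_eq_zero] at hz
    simpa [hq.1] using congrArg star hz

/-- Every sequence in a C*-algebra has the same left annihilator as some single element. -/
theorem exists_mul_eq_zero_iff_forall (a : ℕ → A) :
    ∃ b : A, ∀ z, (∀ n, z * a n = 0) ↔ z * b = 0 := by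
  let _ := CStarAlgebra.spectralOrder A
  let _ := CStarAlgebra.spectralOrderedRing A
  let c : ℕ → ℝ := fun n => (1 / 2) ^ n / (1 + ‖a n * star (a n)‖)
  have hc : ∀ n, 0 < c n := fun n => by positivity
  let f : ℕ → A := fun n => c n • (a n * star (a n))
  have hf : Summable f := by
    refine Summable.of_norm_bounded (summable_geometric_two) fun n => ?_
    have : 0 < 1 + ‖a n * star (a n)‖ := by positivity
    rw [norm_smul, Real.norm_of_nonneg (hc n).le, div_mul_eq_mul_div, div_le_iff₀ this]
    gcongr
    linarith
  refine ⟨∑' n, f n, fun z => ⟨fun h => ?_, fun h n => ?_⟩⟩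
  · rw [← hf.tsum_mul_left z]
    have : ∀ n, z * f n = 0 := fun n => by
      simp only [f, mul_smul_comm, ← mul_assoc, h n, zero_mul, smul_zero]
    simp [this]
  · have hs : Summable fun n => z * f n * star z := (hf.mul_left z).mul_right _
    have hz : ∑' n, z * f n * star z = 0 := by
      rw [(hf.mul_left z).tsum_mul_right, hf.tsum_mul_left, h, zero_mul]
    have hn : ∀ n, z * f n * star z = c n • ((z * a n) * star (z * a n)) := fun n => by
      simp only [f, mul_smul_comm, smul_mul_assoc, star_mul, mul_assoc]
    have h0 : ∀ n, 0 ≤ z * f n * star z := fun n => by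
      rw [hn]
      exact smul_nonneg (hc n).le (mul_star_self_nonneg _)
    have h1 : z * f n * star z = 0 :=
      le_antisymm (hz ▸ hs.le_tsum n fun j _ => h0 j) (h0 n)
    rw [hn, smul_eq_zero] at h1
    exact (CStarRing.mul_star_self_eq_zero_iff _).1 (h1.resolve_left (hc n).ne')

/-- In a Rickart C*-algebra every sequence has a supremum of left projections. -/
theorem IsRickart.exists_iSup_leftProjection (hR : IsRickart A) (a : ℕ → A) :
    ∃ p : A, IsProjection p ∧ ∀ z, (∀ n, z * a n = 0) ↔ z * p = 0 := by
  obtain ⟨b, hb⟩ := exists_mul_eq_zero_iff_forall a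
  obtain ⟨p, hp, h⟩ := hR.exists_leftProjection b
  exact ⟨p, hp, fun z => (hb z).trans (h z)⟩

/-- The sum of a sequence of partial isometries with orthogonal initial projections and orthogonal
final projections exists when initial projections are also orthogonal to final projections. -/
theorem IsRickart.exists_sum_partialIsometry (hR : IsRickart A) (v : ℕ → A)
    (hv : ∀ n, v n * (star (v n) * v n) = v n)
    (hi : ∀ m n, m ≠ n → v m * star (v n) = 0) (hf : ∀ m n, m ≠ n → star (v m) * v n = 0)
    (h0 : ∀ m n, v m * v n = 0) :
    ∃ w : A, w * (star w * w) = w ∧ (∀ n, w * (star (v n) * v n) = v n) ∧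
      (∀ n, v n * (star (v n) * w) = v n) ∧
      (∀ z, (∀ n, z * star (v n) = 0) ↔ z * star w = 0) ∧
      (∀ z, (∀ n, z * v n = 0) ↔ z * w = 0) := by
  have hv' : ∀ n, star (v n) * (v n * star (v n)) = star (v n) := fun n =>
    star_mul_mul_star_self (hv n)
  have h0' : ∀ m n, star (v m) * star (v n) = 0 := fun m n => by rw [← star_mul, h0, star_zero]
  let e : ℕ → A := fun n => star (v n) * v n + v n * star (v n)
  let g : ℕ → A := fun n => (1 / 2 : ℝ) • (e n + v n + star (v n))
  obtain ⟨E, hE, hE'⟩ := hR.exists_iSup_leftProjection fun n => star (v n)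
  obtain ⟨F, hF, hF'⟩ := hR.exists_iSup_leftProjection v
  obtain ⟨G, hG, hG'⟩ := hR.exists_iSup_leftProjection g
  have hFv : ∀ n, F * v n = v n := fun n => by
    have := (hF' (1 - F)).2 (by simp [sub_mul, hF.2]) n
    rwa [sub_mul, one_mul, sub_eq_zero, eq_comm] at this
  have hEv : ∀ n, E * star (v n) = star (v n) := fun n => by
    have := (hE' (1 - E)).2 (by simp [sub_mul, hE.2]) n
    rwa [sub_mul, one_mul, sub_eq_zero, eq_comm] at this
  have hvE : ∀ n, v n * E = v n := fun n => by simpa [hE.1] using congrArg star (hEv n)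
  have hvF : ∀ n, star (v n) * F = star (v n) := fun n => by
    simpa [hF.1] using congrArg star (hFv n)
  have hFs : ∀ n, F * star (v n) = 0 := fun n => by
    have : v n * F = 0 := (hF' (v n)).1 fun m => h0 n m
    simpa [hF.1] using congrArg star this
  have hEs : ∀ n, v n * F = 0 := fun n => (hF' (v n)).1 fun m => h0 n m
  have hsE : ∀ n, star (v n) * E = 0 := fun n => (hE' (star (v n))).1 fun m => h0' n m
  have hge : ∀ n, (e n - g n) * G = 0 := fun n => by
    refine (hG' _).1 fun m => ?_
    simp only [e, g]
    rcases eq_or_ne n m with rfl | h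
    · simp only [sub_mul, add_mul, mul_add, smul_mul_assoc, mul_smul_comm, mul_assoc,
        h0, h0', hv, hv', mul_mul_eq_of_mul_eq (h0 _ _), mul_mul_eq_of_mul_eq (h0' _ _), zero_mul,
        mul_zero, add_zero, zero_add, smul_add]
      module
    · simp [sub_mul, add_mul, mul_add, mul_assoc,
        h0, h0', mul_mul_eq_of_mul_eq (h0 _ _), mul_mul_eq_of_mul_eq (h0' _ _),
        mul_mul_eq_of_mul_eq (hi _ _ h), mul_mul_eq_of_mul_eq (hf _ _ h), hi _ _ h, hf _ _ h]
  have hes : ∀ n, star (e n) = e n := fun n => by simp [e]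
  have hgs : ∀ n, star (g n) = g n := fun n => by
    simp only [g, star_smul, star_add, hes, star_star, star_trivial, add_right_comm]
  have hGe : ∀ n, G * e n = G * g n := fun n => by
    have := congrArg star (hge n)
    rw [star_mul, star_sub, hes, hgs, hG.1, star_zero, mul_sub, sub_eq_zero] at this
    exact this
  have hGg : ∀ n, G * g n = g n := fun n => by
    have := (hG' (1 - G)).2 (by simp [sub_mul, hG.2]) n
    rwa [sub_mul, one_mul, sub_eq_zero, eq_comm] at this
  have hgG : ∀ n, g n * G = g n := fun n => by simpa [hG.1, hgs] using congrArg star (hGg n)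
  have heG : ∀ n, e n * G = g n := fun n => by
    have := hge n
    rw [sub_mul, sub_eq_zero] at this
    rw [this, hgG]
  have hGes : ∀ n, G * star (v n) = g n * star (v n) := fun n => by
    have h1 : star (v n) = e n * star (v n) := by
      simp only [e, add_mul, mul_assoc, h0', hv', mul_zero, add_zero]
    conv_lhs => rw [h1]
    rw [← mul_assoc, hGe, hGg]
  have hsG : ∀ n, star (v n) * G = star (v n) * g n := fun n => by
    have h1 : star (v n) = star (v n) * e n := by
      simp only [e, mul_add, mul_mul_eq_of_mul_eq (h0' _ _), hv', zero_mul, zero_add]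
    conv_lhs => rw [h1]
    rw [mul_assoc, heG]
  let w : A := (2 : ℝ) • (F * G * E)
  have hws : star w = (2 : ℝ) • (E * G * F) := by
    simp only [w, star_smul, star_mul, hE.1, hF.1, hG.1, star_trivial, mul_assoc]
  have hwv : ∀ n, w * star (v n) = v n * star (v n) := fun n => by
    simp only [w, smul_mul_assoc, mul_assoc, hEv, hGes]
    simp only [g, e, mul_add, add_mul, smul_mul_assoc, mul_smul_comm, mul_assoc, h0', hv', mul_zero,
      hFs, mul_mul_eq_of_mul_eq (hFv n), add_zero]
    module
  have hvw : ∀ n, star (v n) * w = star (v n) * v n := fun n => by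
    simp only [w, mul_smul_comm, mul_assoc, mul_mul_eq_of_mul_eq (hvF _),
      mul_mul_eq_of_mul_eq (hsG _)]
    simp only [g, e, mul_add, add_mul, smul_mul_assoc, mul_smul_comm, mul_assoc, mul_zero,
      mul_mul_eq_of_mul_eq (h0' _ _), hvE, hsE, zero_mul, add_zero, zero_add]
    module
  have hwE : w * E = w := by simp only [w, smul_mul_assoc, mul_assoc, hE.2]
  have hFw : F * w = w := by
    simp only [w, mul_smul_comm, ← mul_assoc, hF.2]
  have hEw : E * star w = star w := by simpa [hE.1] using congrArg star hwE
  have hwF : star w * F = star w := by simpa [hF.1] using congrArg star hFw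
  have hwn : ∀ n, star w * (v n) = star (v n) * v n := fun n => by
    simpa using congrArg star (hvw n)
  have hwwE : star w * w = E := by
    have h1 : (star w * w - E) * E = 0 := (hE' _).1 fun n => by
      rw [sub_mul, mul_assoc, hwv, ← mul_assoc, hwn, hEv, mul_assoc, hv', sub_self]
    rwa [sub_mul, mul_assoc, hwE, hE.2, sub_eq_zero] at h1
  have hwnF : ∀ n, v n * star w = v n * star (v n) := fun n => by
    simpa using congrArg star (hwv n)
  have hwwF : w * star w = F := by
    have h1 : (w * star w - F) * F = 0 := (hF' _).1 fun n => by
      rw [sub_mul, mul_assoc, hwn, ← mul_assoc, hwv, hFv, mul_assoc, hv, sub_self]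
    rwa [sub_mul, mul_assoc, hwF, hF.2, sub_eq_zero] at h1
  refine ⟨w, by rw [hwwE, hwE], fun n => ?_, fun n => ?_, fun z => ?_, fun z => ?_⟩
  · rw [← mul_assoc, hwv, mul_assoc, hv]
  · rw [hvw, hv]
  · rw [hE', ← hwwE]
    simpa using mul_self_star_eq_zero_iff (z := z) (a := star w)
  · rw [hF', ← hwwF, mul_self_star_eq_zero_iff]

theorem mul_eq_self_of_left_annihilator {p a : A} (hp : IsProjection p)
    (h : ∀ z, z * p = 0 → z * a = 0) : p * a = a := by
  have := h (1 - p) (by simp [sub_mul, hp.2])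
  rwa [sub_mul, one_mul, sub_eq_zero, eq_comm] at this

/-- In a Rickart C*-algebra every self-adjoint element `h` has a sign, which inherits the
intertwining relations of `h`. -/
theorem IsRickart.exists_sign (hR : IsRickart A) {h : A} (hh : IsSelfAdjoint h) :
    ∃ s : A, star s = s ∧ s * (s * s) = s ∧ (∀ z, z * h = 0 ↔ z * s = 0) ∧
      ∀ a b, h * a = b * h → h * b = a * h → s * a = b * s := by
  let x : A := cfc (fun t : ℝ => max t 0) h
  let y : A := cfc (fun t : ℝ => max (-t) 0) h
  let m : A := cfc (fun t : ℝ => |t|) h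
  have hx : star x = x := (cfc_predicate (fun t : ℝ => max t 0) h).star_eq
  have hy : star y = y := (cfc_predicate (fun t : ℝ => max (-t) 0) h).star_eq
  have hm : star m = m := (cfc_predicate (fun t : ℝ => |t|) h).star_eq
  have hxy : x * y = 0 := by
    simp only [x, y]
    rw [← cfc_mul _ _ h, ← cfc_zero ℝ h]
    refine cfc_congr fun t _ => ?_
    rcases le_total t 0 with ht | ht <;> simp [ht]
  have hyx : y * x = 0 := mul_eq_zero_comm_of_star hx hy hxy
  have h_eq : h = x - y := by
    simp only [x, y]
    rw [← cfc_sub _ _ h]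
    conv_lhs => rw [← cfc_id ℝ h]
    refine cfc_congr fun t _ => ?_
    rcases le_total t 0 with ht | ht <;> simp [ht]
  have m_eq : m = x + y := by
    simp only [x, y, m]
    rw [← cfc_add h _ _]
    refine cfc_congr fun t _ => ?_
    rcases le_total t 0 with ht | ht <;> simp [ht, abs_of_nonpos, abs_of_nonneg]
  have m_comm : ∀ a, h * h * a = a * (h * h) → m * a = a * m := fun a ha => by
    have h1 : m = cfc Real.sqrt (h * h) := by
      have h2 : h * h = cfc (fun t : ℝ => t * t) h := by
        rw [cfc_mul _ _ h, cfc_id' ℝ h]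
      rw [h2, ← cfc_comp' Real.sqrt (fun t : ℝ => t * t) h]
      refine cfc_congr fun t _ => ?_
      exact (Real.sqrt_mul_self_eq_abs t).symm
    rw [h1]
    exact Commute.cfc_real ha _
  obtain ⟨E, hE, hE'⟩ := hR.exists_leftProjection x
  obtain ⟨F, hF, hF'⟩ := hR.exists_leftProjection y
  have hEx : E * x = x := mul_eq_self_of_left_annihilator hE fun z => (hE' z).2
  have hFy : F * y = y := mul_eq_self_of_left_annihilator hF fun z => (hF' z).2
  have hEy : E * y = 0 := mul_eq_zero_comm_of_star hy hE.1 ((hE' y).1 hyx)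
  have hFx : F * x = 0 := mul_eq_zero_comm_of_star hx hF.1 ((hF' x).1 hxy)
  have hEF : E * F = 0 := (hF' E).1 hEy
  have hFE : F * E = 0 := (hE' F).1 hFx
  have hs : star (E - F) = E - F := by rw [star_sub, hE.1, hF.1]
  have hsss : (E - F) * ((E - F) * (E - F)) = E - F := by
    simp [mul_sub, mul_add, sub_mul, hE.2, hF.2, hEF, hFE, ← sub_eq_add_neg]
  have hsm : (E - F) * m = h := by
    rw [m_eq, h_eq]; simp [mul_add, sub_mul, hEx, hFy, hEy, hFx, ← sub_eq_add_neg]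
  have hms : m * (E - F) = h := by
    simpa [hm, hs, hh.star_eq] using congrArg star hsm
  have hsh : (E - F) * h = m := by
    rw [m_eq, h_eq]; simp [mul_sub, sub_mul, hEx, hFy, hEy, hFx, sub_neg_eq_add]
  have hzx : ∀ z u : A, star u = u → z * (u * u) = 0 → z * u = 0 := fun z u hu hz => by
    rw [← mul_self_star_eq_zero_iff, hu, hz]
  have hz : ∀ z, z * h = 0 ↔ z * (E - F) = 0 := fun z => by
    constructor
    · intro hz
      have h1 : z * x = 0 := hzx z x hx <| by
        have : z * (h * x) = 0 := by rw [← mul_assoc, hz, zero_mul]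
        simpa [h_eq, sub_mul, hyx] using this
      have h2 : z * y = 0 := hzx z y hy <| by
        have : z * (h * y) = 0 := by rw [← mul_assoc, hz, zero_mul]
        simpa [h_eq, sub_mul, hxy] using this
      rw [mul_sub, (hE' z).1 h1, (hF' z).1 h2, sub_zero]
    · intro hz
      rw [← hsm, ← mul_assoc, hz, zero_mul]
  generalize E - F = s at *
  refine ⟨s, hs, hsss, hz, fun a b hab hba => ?_⟩
  have hha : h * h * a = a * (h * h) := by
    rw [mul_assoc, hab, ← mul_assoc, hba, mul_assoc]
  have hma := m_comm a hha
  have h1 : s * a * s = b * s * s := by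
    have : (s * a - b * s) * s = 0 := by
      refine (hz _).1 ?_
      rw [← hms, ← mul_assoc]
      have : (s * a - b * s) * m = 0 := by
        rw [sub_mul, mul_assoc, ← hma, ← mul_assoc, hsm, mul_assoc, hsm, hab, sub_self]
      rw [this, zero_mul]
    rwa [sub_mul, sub_eq_zero] at this
  have h2 : s * (a * (1 - s * s)) = 0 := by
    have h3 : h * (1 - s * s) = 0 := by
      have : (1 - s * s) * s = 0 := by simp [sub_mul, mul_assoc, hsss]
      have := (hz _).2 this
      simpa [hh.star_eq, hs] using congrArg star this
    have h4 : star (a * (1 - s * s)) * (h * h) = 0 := by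
      have : h * h * (a * (1 - s * s)) = 0 := by
        rw [← mul_assoc, hha, mul_assoc, mul_assoc, h3, mul_zero, mul_zero]
      simpa [hh.star_eq, mul_assoc] using congrArg star this
    have h5 := (hz _).1 (hzx _ _ hh.star_eq h4)
    simpa [hs] using congrArg star h5
  rw [mul_sub, mul_sub, mul_one, sub_eq_zero] at h2
  rw [h2, ← mul_assoc, ← mul_assoc, h1, mul_assoc, mul_assoc, hsss]

/-- Two projections in a Rickart C*-algebra have equivalent subprojections whose complements are
orthogonal. -/
theorem IsRickart.exists_partialIsometry_of_projections (hR : IsRickart A) {p q : A}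
    (hp : IsProjection p) (hq : IsProjection q) :
    ∃ v : A, v * (star v * v) = v ∧ v * p = v ∧ q * v = v ∧
      (q - v * star v) * (p - star v * v) = 0 := by
  have hh : IsSelfAdjoint (p + q - 1) := by
    rw [IsSelfAdjoint, star_sub, star_add, hp.1, hq.1, star_one]
  obtain ⟨s, hs, hsss, hz, hint⟩ := hR.exists_sign hh
  have hsp : s * p = q * s := hint p q (by simp [mul_sub, sub_mul, mul_add, add_mul, hp.2, hq.2])
    (by simp [mul_sub, sub_mul, mul_add, add_mul, hp.2, hq.2])
  have hsq : s * q = p * s := by simpa [hs, hp.1, hq.1] using (congrArg star hsp).symm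
  have h0 : (1 - s * s) * (p + q - 1) = 0 := (hz _).2 (by simp [sub_mul, mul_assoc, hsss])
  have hsv : star (s * p) = p * s := by simp [hs, hp.1]
  have h1 : s * p * (p * s) = q * (s * s) := by
    rw [mul_assoc, ← mul_assoc p p, hp.2, ← mul_assoc, hsp, mul_assoc]
  have h2 : p * s * (s * p) = p * (s * s) := by
    rw [hsp, mul_assoc, ← mul_assoc s q, hsq, ← mul_assoc, ← mul_assoc, hp.2, mul_assoc]
  have hps : p * (s * s) = s * s * p := by
    rw [mul_assoc, hsp, ← mul_assoc, ← mul_assoc, hsq]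
  have hqs : q * (s * s) = s * s * q := by
    rw [mul_assoc, hsq, ← mul_assoc, ← mul_assoc, hsp]
  refine ⟨s * p, ?_, by rw [mul_assoc, hp.2], by rw [hsp, ← mul_assoc, hq.2], ?_⟩
  · rw [hsv, h2, hps, mul_assoc, ← mul_assoc p, hps]
    simp only [mul_assoc, hp.2, mul_mul_mul_eq_of_mul_mul_eq hsss]
  · rw [hsv, h1, h2, hqs]
    have h3 : (p + q - 1) * p = q * p := by simp [sub_mul, add_mul, hp.2]
    calc (q - s * s * q) * (p - p * (s * s))
        = (1 - s * s) * (q * p) * (1 - s * s) := by noncomm_ring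
      _ = 0 := by rw [← h3, ← mul_assoc, h0, zero_mul, zero_mul]

/-- Polar decomposition of an element of square zero in a Rickart C*-algebra. -/
theorem IsRickart.exists_polar_of_mul_self_eq_zero (hR : IsRickart A) {x : A} (hx : x * x = 0) :
    ∃ v : A, v * (star v * v) = v ∧ (∀ z, z * x = 0 ↔ z * v = 0) ∧
      (∀ z, z * star x = 0 ↔ z * star v = 0) := by
  obtain ⟨F, hF, hF'⟩ := hR.exists_leftProjection x
  obtain ⟨E, hE, hE'⟩ := hR.exists_leftProjection (star x)
  have hFx : F * x = x := mul_eq_self_of_left_annihilator hF fun z => (hF' z).2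
  have hEx : E * star x = star x := mul_eq_self_of_left_annihilator hE fun z => (hE' z).2
  have hxE : x * E = x := by simpa [hE.1] using congrArg star hEx
  have hxF : star x * F = star x := by simpa [hF.1] using congrArg star hFx
  have hxF0 : x * F = 0 := (hF' x).1 hx
  have hxE0 : star x * E = 0 := (hE' _).1 (by rw [← star_mul, hx, star_zero])
  have hFs0 : F * star x = 0 := by simpa [hF.1] using congrArg star hxF0
  have hE0 : E * x = 0 := by simpa [hE.1] using congrArg star hxE0
  have hEF : E * F = 0 := (hF' E).1 hE0
  have hFE : F * E = 0 := mul_eq_zero_comm_of_star hE.1 hF.1 hEF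
  obtain ⟨s, hs, hsss, hz, hint⟩ := hR.exists_sign (h := x + star x)
    (by simp [IsSelfAdjoint, add_comm])
  have hsE : s * E = F * s := hint E F (by simp [add_mul, mul_add, hxE, hxE0, hFx, hFs0])
    (by simp [add_mul, mul_add, hxF, hxF0, hEx, hE0])
  have hsF : s * F = E * s := by simpa [hs, hE.1, hF.1] using (congrArg star hsE).symm
  have hssE : s * s * E = E := by
    have h1 : (1 - s * s) * (x + star x) = 0 := (hz _).2 (by simp [sub_mul, mul_assoc, hsss])
    have h2 : (1 - s * s) * star x = 0 := by
      have := congrArg (· * F) h1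
      simpa [mul_assoc, add_mul, hxF, hxF0] using this
    have := (hE' _).1 h2
    rwa [sub_mul, one_mul, sub_eq_zero, eq_comm] at this
  have hssF : s * s * F = F := by
    have h1 : (1 - s * s) * (x + star x) = 0 := (hz _).2 (by simp [sub_mul, mul_assoc, hsss])
    have h2 : (1 - s * s) * x = 0 := by
      have := congrArg (· * E) h1
      simpa [mul_assoc, add_mul, hxE, hxE0] using this
    have := (hF' _).1 h2
    rwa [sub_mul, one_mul, sub_eq_zero, eq_comm] at this
  have hsv : star (s * E) = E * s := by simp [hs, hE.1]
  have h1 : E * s * (s * E) = E := by rw [mul_assoc, ← mul_assoc s, hssE, hE.2]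
  have h2 : s * E * (E * s) = F := by
    rw [mul_assoc, ← mul_assoc E, hE.2, ← hsF, ← mul_assoc, hssF]
  refine ⟨s * E, by rw [hsv, h1, mul_assoc, hE.2], fun z => ?_, fun z => ?_⟩
  · rw [hF', ← h2, ← hsv, mul_self_star_eq_zero_iff]
  · have := mul_self_star_eq_zero_iff (z := z) (a := star (s * E))
    rw [star_star, hsv, h1] at this
    rw [hE', this, hsv]

end CStar

/-- The sequence defined by strong recursion, each term being computed from the truncation of the
sequence to the previous terms. -/
def seqOfTruncation {α : Type*} [Zero α] (F : ℕ → (ℕ → α) → α) : ℕ → α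
  | n => F n fun i => if _ : i < n then seqOfTruncation F i else 0

theorem exists_seq_eq_truncation {α : Type*} [Zero α] (F : ℕ → (ℕ → α) → α) :
    ∃ v : ℕ → α, ∀ n, v n = F n fun i => if i < n then v i else 0 :=
  ⟨seqOfTruncation F, fun n => by rw [seqOfTruncation]; simp only [dite_eq_ite]⟩

section StarWord

variable {R : Type*} [Ring R] [StarRing R]

/-- The letters `y i`, `f i` and their adjoints. -/
def starLetter (y f : ℕ → R) (l : Bool × Bool × ℕ) : R :=
  if l.1 then (if l.2.1 then y l.2.2 else f l.2.2) else star (if l.2.1 then y l.2.2 else f l.2.2)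

/-- The value of a word in the letters `y i`, `f i` and their adjoints. -/
def starWord (y f : ℕ → R) (w : List (Bool × Bool × ℕ)) : R :=
  (w.map (starLetter y f)).prod

theorem exists_starWord_congr (y v : ℕ → R) (w : List (Bool × Bool × ℕ)) :
    ∃ M, ∀ f : ℕ → R, (∀ i < M, f i = v i) → starWord y f w = starWord y v w := by
  induction w with
  | nil => exact ⟨0, fun f _ => rfl⟩
  | cons l w ih =>
    obtain ⟨M, hM⟩ := ih
    refine ⟨max M (l.2.2 + 1), fun f hf => ?_⟩
    have h1 := hM f fun i hi => hf i (lt_max_of_lt_left hi)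
    have h2 := hf l.2.2 (lt_max_of_lt_right (Nat.lt_succ_self _))
    simp only [starWord, List.map_cons, List.prod_cons] at h1 ⊢
    rw [h1, starLetter, starLetter, h2]

end StarWord

section CStar

variable {A : Type*} [CStarAlgebra A]

theorem mul_eq_self_of_one_sub_mul_eq_zero {R : Type*} [Ring R] {p a : R} (h : (1 - p) * a = 0) :
    p * a = a := by
  rwa [sub_mul, one_mul, sub_eq_zero, eq_comm] at h

theorem commute_of_mul_mul_eq {C x : A} (hC : IsProjection C) (h : (1 - C) * (x * C) = 0)
    (h' : (1 - C) * (star x * C) = 0) : C * x = x * C := by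
  have h1 : C * (x * C) = x * C := by rwa [sub_mul, one_mul, sub_eq_zero, eq_comm] at h
  have h2 : C * (star x * C) = star x * C := by rwa [sub_mul, one_mul, sub_eq_zero, eq_comm] at h'
  have h3 : C * (x * C) = C * x := by simpa [hC.1, mul_assoc] using congrArg star h2
  rw [← h3, h1]

/-- General comparability of two orthogonal projections, relative to a sequence of elements which
the central projection is only required to commute with. -/
theorem IsRickart.exists_comparison_of_orthogonal (hR : IsRickart A) (y : ℕ → A) {P Q : A}
    (hP : IsProjection P) (hQ : IsProjection Q) (hPQ : P * Q = 0) :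
    ∃ v C : A, v * (star v * v) = v ∧ v * P = v ∧ Q * v = v ∧ IsProjection C ∧
      (∀ i, C * y i = y i * C) ∧ C * v = v * C ∧
      C * (P - star v * v) = P - star v * v ∧ C * (Q - v * star v) = 0 := by
  classical
  have hpol : ∀ x : A, ∃ v : A, x * x = 0 → v * (star v * v) = v ∧ (∀ z, z * x = 0 ↔ z * v = 0) ∧
      (∀ z, z * star x = 0 ↔ z * star v = 0) := fun x => by
    by_cases hx : x * x = 0
    · obtain ⟨v, hv⟩ := hR.exists_polar_of_mul_self_eq_zero hx
      exact ⟨v, fun _ => hv⟩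
    · exact ⟨0, fun h => absurd h hx⟩
  choose pol hpol using hpol
  obtain ⟨σ, hσ⟩ := exists_surjective_nat (List (Bool × Bool × ℕ))
  obtain ⟨v, hv⟩ := exists_seq_eq_truncation fun n f =>
    pol ((Q - ∑ i ∈ Finset.range n, f i * star (f i)) * (starWord y f (σ n.unpair.1) *
      (P - ∑ i ∈ Finset.range n, star (f i) * f i)))
  let p : ℕ → A := fun n => P - ∑ i ∈ Finset.range n, star (v i) * v i
  let q : ℕ → A := fun n => Q - ∑ i ∈ Finset.range n, v i * star (v i)
  let a : ℕ → A := fun n =>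
    q n * (starWord y (fun i => if i < n then v i else 0) (σ n.unpair.1) * p n)
  have hva : ∀ n, v n = pol (a n) := fun n => by
    refine (hv n).trans (congrArg pol ?_)
    simp only [a, p, q]
    congr 2
    · refine Finset.sum_congr rfl fun i hi => ?_
      rw [if_pos (Finset.mem_range.1 hi)]
    · refine congrArg (P - ·) (Finset.sum_congr rfl fun i hi => ?_)
      rw [if_pos (Finset.mem_range.1 hi)]
  have hp_succ : ∀ n, p (n + 1) = p n - star (v n) * v n := fun n => by
    simp only [p, Finset.sum_range_succ, sub_sub]
  have hq_succ : ∀ n, q (n + 1) = q n - v n * star (v n) := fun n => by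
    simp only [q, Finset.sum_range_succ, sub_sub]
  have step : ∀ n, (IsProjection (p n) ∧ IsProjection (q n) ∧ P * p n = p n ∧ Q * q n = q n) →
      v n * (star (v n) * v n) = v n ∧ v n * p n = v n ∧ q n * v n = v n ∧
        v n * (star (v n) * a n) = a n := by
    rintro n ⟨hpn, hqn, hPp, hQq⟩
    have hpq : p n * q n = 0 := by
      have hpP : p n * P = p n := by simpa [hP.1, hpn.1] using congrArg star hPp
      rw [← hpP, ← hQq, mul_assoc, mul_mul_eq_of_mul_eq hPQ, zero_mul, mul_zero]
    have ha : a n * a n = 0 := by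
      simp only [a, mul_assoc, mul_mul_eq_of_mul_eq hpq, zero_mul, mul_zero]
    obtain ⟨h1, h2, h3⟩ := hpol _ ha
    rw [← hva] at h1 h2 h3
    refine ⟨h1, ?_, ?_, ?_⟩
    · have := (h3 (1 - p n)).1 (by simp [a, sub_mul, mul_assoc, hpn.1, hqn.1,
        mul_mul_eq_of_mul_eq hpn.2])
      simpa [hpn.1] using congrArg star (mul_eq_self_of_one_sub_mul_eq_zero this)
    · have := (h2 (1 - q n)).1 (by simp [a, sub_mul, mul_mul_eq_of_mul_eq hqn.2])
      exact mul_eq_self_of_one_sub_mul_eq_zero this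
    · have := (h2 (1 - v n * star (v n))).2 (by simp [sub_mul, mul_assoc, h1])
      simpa [mul_assoc] using mul_eq_self_of_one_sub_mul_eq_zero this
  have inv : ∀ n, IsProjection (p n) ∧ IsProjection (q n) ∧ P * p n = p n ∧ Q * q n = q n := by
    intro n
    induction n with
    | zero => simp [p, q, hP, hQ, hP.2, hQ.2]
    | succ n ih =>
      obtain ⟨h1, h2, h3, -⟩ := step n ih
      obtain ⟨hpn, hqn, hPp, hQq⟩ := ih
      have h4 : p n * star (v n) = star (v n) := by simpa [hpn.1] using congrArg star h2
      have h5 : P * star (v n) = star (v n) := by rw [← h4, ← mul_assoc, hPp]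
      have h6 : Q * v n = v n := by rw [← h3, ← mul_assoc, hQq]
      rw [hp_succ, hq_succ]
      refine ⟨hpn.sub (isProjection_star_mul_self h1) (by rw [← mul_assoc, h4]),
        hqn.sub (isProjection_mul_star_self h1) (by rw [← mul_assoc, h3]), ?_, ?_⟩
      · rw [mul_sub, hPp, ← mul_assoc, h5]
      · rw [mul_sub, hQq, ← mul_assoc, h6]
  have hvv n : v n * (star (v n) * v n) = v n := (step n (inv n)).1
  have hvp n : v n * p n = v n := (step n (inv n)).2.1
  have hqv n : q n * v n = v n := (step n (inv n)).2.2.1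
  have hva' n : v n * (star (v n) * a n) = a n := (step n (inv n)).2.2.2
  have hpv n : p n * star (v n) = star (v n) := by
    simpa [(inv n).1.1] using congrArg star (hvp n)
  have hvq n : star (v n) * q n = star (v n) := by
    simpa [(inv n).2.1.1] using congrArg star (hqv n)
  have hPv n : P * star (v n) = star (v n) := by rw [← hpv, ← mul_assoc, (inv n).2.2.1]
  have hQv n : Q * v n = v n := by rw [← hqv, ← mul_assoc, (inv n).2.2.2]
  have hvP n : v n * P = v n := by simpa [hP.1] using congrArg star (hPv n)
  have hvQ n : star (v n) * Q = star (v n) := by simpa [hQ.1] using congrArg star (hQv n)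
  have hvp0 : ∀ m n, m < n → v m * p n = 0 := fun m n hmn => by
    induction n, hmn using Nat.le_induction with
    | base => rw [hp_succ, mul_sub, hvp, hvv, sub_self]
    | succ n _ ih =>
      rw [hp_succ, mul_sub, ih, ← hpv, ← mul_assoc, ← mul_assoc, ih, zero_mul, zero_mul, sub_zero]
  have hvq0 : ∀ m n, m < n → star (v m) * q n = 0 := fun m n hmn => by
    induction n, hmn using Nat.le_induction with
    | base => rw [hq_succ, mul_sub, hvq, star_mul_mul_star_self (hvv m), sub_self]
    | succ n _ ih =>
      rw [hq_succ, mul_sub, ih, ← hqv n, ← mul_assoc, ← mul_assoc, ih, zero_mul, zero_mul, sub_zero]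
  have hi' : ∀ m n, m < n → v m * star (v n) = 0 := fun m n hmn => by
    rw [← hpv, ← mul_assoc, hvp0 m n hmn, zero_mul]
  have hf' : ∀ m n, m < n → star (v m) * v n = 0 := fun m n hmn => by
    rw [← hqv n, ← mul_assoc, hvq0 m n hmn, zero_mul]
  have hi : ∀ m n, m ≠ n → v m * star (v n) = 0 := fun m n hmn => by
    rcases hmn.lt_or_gt with h | h
    · exact hi' m n h
    · simpa using congrArg star (hi' n m h)
  have hf : ∀ m n, m ≠ n → star (v m) * v n = 0 := fun m n hmn => by
    rcases hmn.lt_or_gt with h | h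
    · exact hf' m n h
    · simpa using congrArg star (hf' n m h)
  have h0 : ∀ m n, v m * v n = 0 := fun m n => by
    rw [← hvP, ← hQv n, mul_assoc, mul_mul_eq_of_mul_eq hPQ, zero_mul, mul_zero]
  obtain ⟨w, hw, hw1, hw2, hw3, hw4⟩ := hR.exists_sum_partialIsometry v hvv hi hf h0
  have hPw : P * star w = star w := by
    have := (hw3 (1 - P)).1 fun n => by simp [sub_mul, hPv]
    rwa [sub_mul, one_mul, sub_eq_zero, eq_comm] at this
  have hQw : Q * w = w := by
    have := (hw4 (1 - Q)).1 fun n => by simp [sub_mul, hQv]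
    rwa [sub_mul, one_mul, sub_eq_zero, eq_comm] at this
  have hwP : w * P = w := by simpa [hP.1] using congrArg star hPw
  have hvw n : star (v n) * w = star (v n) * v n := by
    rw [← star_mul_mul_star_self (hvv n), mul_assoc, mul_assoc, hw2]
    simp only [mul_assoc, hvv]
  have hwv n : w * star (v n) = v n * star (v n) := by
    rw [← star_mul_mul_star_self (hvv n), ← mul_assoc (star _), ← mul_assoc, hw1, mul_assoc,
      star_mul_mul_star_self (hvv n)]
  have hvw' n : v n * star w = v n * star (v n) := by simpa using congrArg star (hwv n)
  have hvP' n : v n * (P - star w * w) = 0 := by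
    rw [mul_sub, hvP, ← mul_assoc, hvw', mul_assoc, hw2, sub_self]
  have hvQ' n : star (v n) * (Q - w * star w) = 0 := by
    rw [mul_sub, hvQ, ← mul_assoc, hvw, mul_assoc, hvw', star_mul_mul_star_self (hvv n), sub_self]
  have hPr : IsProjection (P - star w * w) :=
    hP.sub (isProjection_star_mul_self hw) (by rw [← mul_assoc, hPw])
  have hQr : IsProjection (Q - w * star w) :=
    hQ.sub (isProjection_mul_star_self hw) (by rw [← mul_assoc, hQw])
  have hpP' n : p n * (P - star w * w) = P - star w * w := by
    simp only [p, sub_mul _ _ (P - star w * w), Finset.sum_mul, mul_assoc, hvP', mul_zero,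
      Finset.sum_const_zero, sub_zero]
    rw [mul_sub, hP.2, ← mul_assoc, hPw]
  have hqQ' n : q n * (Q - w * star w) = Q - w * star w := by
    simp only [q, sub_mul _ _ (Q - w * star w), Finset.sum_mul, mul_assoc, hvQ', mul_zero,
      Finset.sum_const_zero, sub_zero]
    rw [mul_sub, hQ.2, ← mul_assoc, hQw]
  have hQ'q n : (Q - w * star w) * q n = Q - w * star w := by
    simpa only [star_mul, hQr.1, (inv n).2.1.1] using congrArg star (hqQ' n)
  have hword : ∀ u, (Q - w * star w) * (starWord y v u * (P - star w * w)) = 0 := fun u => by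
    obtain ⟨M, hM⟩ := exists_starWord_congr y v u
    obtain ⟨k, rfl⟩ := hσ u
    let n := Nat.pair k M
    have hn : starWord y (fun i => if i < n then v i else 0) (σ n.unpair.1) =
        starWord y v (σ k) := by
      simp only [n, Nat.unpair_pair]
      exact hM _ fun i hi => if_pos (hi.trans_le (Nat.right_le_pair k M))
    have h1 : q (n + 1) * a n = 0 := by
      rw [hq_succ, sub_mul, mul_assoc, hva']
      simp only [a, mul_mul_eq_of_mul_eq (inv n).2.1.2, sub_self]
    have h2 : (Q - w * star w) * a n = 0 := by
      rw [← hQ'q (n + 1), mul_assoc, h1, mul_zero]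
    have h3 := congrArg (· * (P - star w * w)) h2
    simp only [a, hn, mul_assoc, hpP', mul_mul_eq_of_mul_eq (hQ'q n), zero_mul] at h3
    exact h3
  obtain ⟨C, hC, hC'⟩ := hR.exists_iSup_leftProjection
    fun n => starWord y v (σ n) * (P - star w * w)
  have hC1 : ∀ u, (1 - C) * (starWord y v u * (P - star w * w)) = 0 := fun u => by
    obtain ⟨k, rfl⟩ := hσ u
    exact (hC' (1 - C)).2 (by simp [sub_mul, hC.2]) k
  have hCl : ∀ l, (1 - C) * (starLetter y v l * C) = 0 := fun l => by
    rw [← mul_assoc]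
    refine (hC' _).1 fun n => ?_
    simpa [starWord, mul_assoc] using hC1 (l :: σ n)
  have hCy i : C * y i = y i * C := commute_of_mul_mul_eq hC
    (by simpa [starLetter] using hCl (true, true, i))
    (by simpa [starLetter] using hCl (false, true, i))
  have hCv i : C * v i = v i * C := commute_of_mul_mul_eq hC
    (by simpa [starLetter] using hCl (true, false, i))
    (by simpa [starLetter] using hCl (false, false, i))
  have hCvs i : C * star (v i) = star (v i) * C := by
    simpa [hC.1] using (congrArg star (hCv i)).symm
  refine ⟨w, C, hw, hwP, hQw, hC, hCy, ?_, ?_, ?_⟩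
  · have h1 : (C * w - w * C) * star w = 0 := (hw3 _).1 fun n => by
      rw [sub_mul, mul_assoc, hwv, mul_assoc, hCvs, ← mul_assoc w, hwv, ← mul_assoc, hCv,
        mul_assoc, mul_assoc, hCvs, sub_self]
    have h2 : star w * (C * w - w * C) = 0 := by
      have h3 : star (C * w - w * C) * w = 0 := (hw4 _).1 fun n => by
        have : star (v n) * (C * w - w * C) = 0 := by
          rw [mul_sub, ← mul_assoc, ← hCvs, mul_assoc, hvw, ← mul_assoc (star _) w, hvw,
            ← mul_assoc, hCvs, mul_assoc, hCv, mul_assoc, sub_self]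
        simpa using congrArg star this
      simpa using congrArg star h3
    rw [sub_mul, sub_eq_zero] at h1
    rw [mul_sub, sub_eq_zero] at h2
    have h3 : star w * (C * w) = C * (star w * w) := by
      simpa [hC.1, mul_assoc] using congrArg star h2
    calc C * w = C * w * star w * w := by simp only [mul_assoc, hw]
      _ = w * (C * (star w * w)) := by rw [h1]; simp only [mul_assoc]
      _ = w * C := by rw [← h3, h2, ← mul_assoc (star w), ← mul_assoc w, hw]
  · have := hC1 []
    simpa [starWord] using mul_eq_self_of_one_sub_mul_eq_zero this
  · exact mul_eq_zero_comm_of_star hQr.1 hC.1 ((hC' _).1 fun n => hword _)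

/-- General comparability of two projections, relative to a sequence of elements which
the central projection is only required to commute with. -/
theorem IsRickart.exists_comparison (hR : IsRickart A) (y : ℕ → A) {P Q : A}
    (hP : IsProjection P) (hQ : IsProjection Q) :
    ∃ v C : A, v * (star v * v) = v ∧ v * P = v ∧ Q * v = v ∧ IsProjection C ∧
      (∀ i, C * y i = y i * C) ∧ C * v = v * C ∧
      C * (P - star v * v) = P - star v * v ∧ C * (Q - v * star v) = 0 := by
  obtain ⟨u, hu, huP, hQu, hQP⟩ := hR.exists_partialIsometry_of_projections hP hQ
  have hPu : P * star u = star u := by simpa [hP.1] using congrArg star huP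
  have hP1 := hP.sub (isProjection_star_mul_self hu) (by rw [← mul_assoc, hPu])
  have hQ1 := hQ.sub (isProjection_mul_star_self hu) (by rw [← mul_assoc, hQu])
  have hPQ := mul_eq_zero_comm_of_star hQ1.1 hP1.1 hQP
  obtain ⟨v, C, hv, hvP, hQv, hC, hCy, hCv, h1, h2⟩ :=
    hR.exists_comparison_of_orthogonal (fun n => Nat.casesOn n u y) hP1 hQ1 hPQ
  have hCu : C * u = u * C := hCy 0
  have huv : u * star v = 0 := by
    have : v * star u = 0 := by
      rw [← hvP, mul_assoc, sub_mul, hPu, mul_assoc, star_mul_mul_star_self hu, sub_self, mul_zero]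
    simpa using congrArg star this
  have hvu : v * star u = 0 := by simpa using congrArg star huv
  have hsvu : star v * u = 0 := by
    have : star u * v = 0 := by
      rw [← hQv, ← mul_assoc, mul_sub, star_mul_mul_star_self hu]
      have : star u * Q = star u := by simpa [hQ.1] using congrArg star hQu
      rw [this, sub_self, zero_mul]
    simpa using congrArg star this
  have hsuv : star u * v = 0 := by simpa using congrArg star hsvu
  have h3 : star (u + v) * (u + v) = star u * u + star v * v := by
    simp [add_mul, mul_add, hsvu, hsuv]
  have h4 : (u + v) * star (u + v) = u * star u + v * star v := by
    simp [add_mul, mul_add, hvu, huv]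
  have hvP' : v * P = v := by
    rw [← hvP, mul_assoc, sub_mul, hP.2, mul_assoc, huP]
  have hQv' : Q * v = v := by
    rw [← hQv, ← mul_assoc, mul_sub, hQ.2, ← mul_assoc, hQu]
  refine ⟨u + v, C, ?_, by rw [add_mul, huP, hvP'], by rw [mul_add, hQu, hQv'], hC,
    fun i => hCy (i + 1), by rw [mul_add, add_mul, hCu, hCv], ?_, ?_⟩
  · rw [h3]
    simp only [add_mul, mul_add, ← mul_assoc, huv, hvu, zero_mul]
    simp only [mul_assoc, hu, hv, add_zero, zero_add]
  · rw [h3, ← sub_sub, h1]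
  · rw [h4, ← sub_sub, h2]

theorem IsFiniteCStar.star_mul_self_eq_one (hfin : IsFiniteCStar A) {u : A} (h : u * star u = 1) :
    star u * u = 1 := by
  refine hfin _ ⟨by simp, ?_⟩ ⟨star u, by simp, by simpa using h⟩
  rw [mul_assoc, ← mul_assoc u, h, one_mul]

theorem cut_mul_star_cut {C g : A} (hC : IsProjection C) (h : C * g = g * C) :
    (C * g + (1 - C)) * star (C * g + (1 - C)) = 1 - C * (1 - g * star g) := by
  have h' : C * star g = star g * C := by simpa [hC.1] using (congrArg star h).symm
  have h1 : C * (1 - C) = 0 := by simp [mul_sub, hC.2]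
  have h2 : star (C * g) = C * star g := by simp [hC.1, h']
  rw [star_add, h2, hC.one_sub.1]
  have h3 : C * g * (C * star g) = C * (g * star g) := by
    rw [h, mul_assoc, mul_mul_eq_of_mul_eq hC.2, ← mul_assoc, ← h, mul_assoc]
  have h4 : C * g * (1 - C) = 0 := by rw [h, mul_assoc, h1, mul_zero]
  have h5 : (1 - C) * (C * star g) = 0 := by rw [← mul_assoc]; simp [sub_mul, hC.2]
  rw [add_mul, mul_add, mul_add, h3, h4, h5, hC.one_sub.2, mul_sub, mul_one]
  abel

theorem star_cut_mul_cut {C g : A} (hC : IsProjection C) (h : C * g = g * C) :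
    star (C * g + (1 - C)) * (C * g + (1 - C)) = 1 - C * (1 - star g * g) := by
  have h' : C * star g = star g * C := by simpa [hC.1] using (congrArg star h).symm
  have h1 : star (C * g + (1 - C)) = C * star g + (1 - C) := by simp [hC.1, h']
  have := cut_mul_star_cut hC h'
  rwa [← h1, star_star, star_star] at this

/-- In a finite Rickart C*-algebra every partial isometry extends to a unitary. -/
theorem IsRickart.exists_unitary_extension (hR : IsRickart A) (hfin : IsFiniteCStar A) {w : A}
    (hw : w * (star w * w) = w) :
    ∃ v : A, star v * v = 1 - star w * w ∧ v * star v = 1 - w * star w := by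
  obtain ⟨v, C, hv, hvP, hQv, hC, hCw, hCv, h1, h2⟩ := hR.exists_comparison (fun _ => w)
    (isProjection_star_mul_self hw).one_sub (isProjection_mul_star_self hw).one_sub
  replace hCw := hCw 0
  have hvw : v * star w = 0 := by
    have h3 : v * (star w * w) = 0 := by simpa [mul_sub] using hvP
    simpa using (mul_self_star_eq_zero_iff (z := v) (a := star w)).1 (by simpa using h3)
  have hwv : w * star v = 0 := by simpa using congrArg star hvw
  have hsvw : star v * w = 0 := by
    have h3 : (w * star w) * v = 0 := by simpa [sub_mul] using hQv
    refine (mul_self_star_eq_zero_iff).1 ?_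
    simpa using congrArg star h3
  have hswv : star w * v = 0 := by simpa using congrArg star hsvw
  have hg : C * (w + v) = (w + v) * C := by rw [mul_add, add_mul, hCw, hCv]
  have hg' : (1 - C) * (w + v) = (w + v) * (1 - C) := by rw [sub_mul, mul_sub, hg]; simp
  have hgs : 1 - (w + v) * star (w + v) = 1 - w * star w - v * star v := by
    rw [star_add, add_mul, mul_add, mul_add, hwv, hvw]; abel
  have hsg : 1 - star (w + v) * (w + v) = 1 - star w * w - star v * v := by
    rw [star_add, add_mul, mul_add, mul_add, hswv, hsvw]; abel
  have e1 := cut_mul_star_cut hC hg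
  have e2 := star_cut_mul_cut hC hg
  have e3 := cut_mul_star_cut hC.one_sub hg'
  have e4 := star_cut_mul_cut hC.one_sub hg'
  rw [hgs] at e1 e3
  rw [hsg] at e2 e4
  rw [h2, sub_zero] at e1
  rw [hfin.star_mul_self_eq_one e1, h1] at e2
  rw [sub_mul 1 C (1 - star w * w - star v * v), h1, one_mul, sub_self, sub_zero] at e4
  rw [← star_star ((1 - C) * (w + v) + (1 - (1 - C))),
    star_star (star _), hfin.star_mul_self_eq_one (by rw [star_star]; exact e4)] at e3
  rw [sub_mul 1 C (1 - w * star w - v * star v), h2, sub_zero, one_mul] at e3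
  refine ⟨v, ?_, ?_⟩
  · rw [eq_comm, sub_eq_self, sub_eq_zero] at e2
    exact e2.symm
  · rw [eq_comm, sub_eq_self, sub_eq_zero] at e3
    exact e3.symm

/-- Cancellation of equivalent projections below `T`. -/
theorem IsRickart.exists_cancel (hR : IsRickart A) (hfin : IsFiniteCStar A) {k s T u r : A}
    (hk : IsProjection k) (hs : IsProjection s) (hT : IsProjection T) (hks : k * s = s)
    (hu : star u * u = k) (hTu : T * u = u) (hr : star r * r = s) (hTr : T * r = r) :
    ∃ t : A, star t * t = k - s ∧ T * t = t ∧ star r * t = 0 := by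
  have hsk : s * k = s := by simpa [hs.1, hk.1] using congrArg star hks
  have huk : u * k = u := mul_eq_self_of_star_mul_self hk.2 hu
  have hrs : r * s = r := mul_eq_self_of_star_mul_self hs.2 hr
  have hku : k * star u = star u := by simpa [hk.1] using congrArg star huk
  have hsr : s * star r = star r := by simpa [hs.1] using congrArg star hrs
  have hrk : r * k = r := by rw [← hrs, mul_assoc, hsk]
  have huT : star u * T = star u := by simpa [hT.1] using congrArg star hTu
  have hrT : star r * T = star r := by simpa [hT.1] using congrArg star hTr
  have h1 : star (r * star u + (1 - T)) * (r * star u + (1 - T)) =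
      1 - (T - u * (s * star u)) := by
    simp only [star_add, star_mul, star_star, star_sub, star_one, hT.1, add_mul, mul_add, mul_sub,
      sub_mul, mul_assoc, mul_mul_eq_of_mul_eq hr, hrT, mul_one, one_mul, hT.2,
      mul_mul_eq_of_mul_eq hTr]
    abel
  have h2 : (r * star u + (1 - T)) * star (r * star u + (1 - T)) =
      1 - (T - r * star r) := by
    simp only [star_add, star_mul, star_star, star_sub, star_one, hT.1, add_mul, mul_add, mul_sub,
      sub_mul, mul_assoc, mul_mul_eq_of_mul_eq hu, huT, mul_one, one_mul, hT.2,
      mul_mul_eq_of_mul_eq hTu, mul_mul_eq_of_mul_eq hrk]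
    abel
  obtain ⟨m, hm, hm'⟩ := hR.exists_unitary_extension hfin (w := r * star u + (1 - T)) <| by
    rw [h1]
    simp only [add_mul, mul_sub, sub_mul, mul_assoc, mul_mul_eq_of_mul_eq hu, huT, mul_one, one_mul,
      hT.2, mul_mul_eq_of_mul_eq hTu, mul_mul_eq_of_mul_eq hks, mul_mul_eq_of_mul_eq hrs]
    abel
  rw [h1, sub_sub_cancel] at hm
  rw [h2, sub_sub_cancel] at hm'
  refine ⟨m * (u * (k - s)), ?_, ?_, ?_⟩
  · rw [star_mul, mul_assoc, mul_mul_eq_of_mul_eq hm]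
    simp only [star_mul, star_sub, hk.1, hs.1, sub_mul, mul_sub, mul_assoc, hk.2, hs.2, hks, hsk,
      mul_mul_eq_of_mul_eq hTu, mul_mul_eq_of_mul_eq hu]
    abel
  · have h3 : (1 - T) * (m * star m) = 0 := by
      rw [hm']
      simp [sub_mul, mul_sub, hT.2, mul_mul_eq_of_mul_eq hTr]
    rw [← mul_assoc, mul_eq_self_of_one_sub_mul_eq_zero (mul_self_star_eq_zero_iff.1 h3)]
  · have h3 : star r * (m * star m) = 0 := by
      rw [hm', mul_sub, hrT, mul_mul_eq_of_mul_eq hr, hsr, sub_self]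
    rw [← mul_assoc, mul_self_star_eq_zero_iff.1 h3, zero_mul]

theorem mul_eq_of_le_of_forall_succ {R : Type*} [Semigroup R] {s : ℕ → R}
    (hs : ∀ n, s n * s n = s n) (h : ∀ n, s n * s (n + 1) = s (n + 1)) {m n : ℕ} (hmn : m ≤ n) :
    s m * s n = s n := by
  induction n, hmn using Nat.le_induction with
  | base => exact hs m
  | succ n _ ih => rw [← h n, ← mul_assoc, ih]

/-- Summation of a sequence of partial isometries along a sequence of projections decreasing to
zero. -/
theorem IsRickart.exists_sum_of_antitone (hR : IsRickart A) {k X : A} {s t : ℕ → A}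
    (hs : ∀ n, IsProjection (s n)) (hs0 : s 0 = k) (hss : ∀ n, s n * s (n + 1) = s (n + 1))
    (hinf : ∀ z, (∀ n, s n * z = z) → z = 0) (hkX : k * X = 0)
    (ht : ∀ n, star (t n) * t n = s n - s (n + 1)) (hXt : ∀ n, X * t n = t n)
    (htt : ∀ m n, m ≠ n → star (t m) * t n = 0) :
    ∃ v : A, star v * v = k ∧ X * v = v ∧ ∀ n, v * (s n - s (n + 1)) = t n := by
  have hp n : IsProjection (s n - s (n + 1)) := (hs n).sub (hs _) (hss n)
  have hle : ∀ {m n}, m ≤ n → s m * s n = s n := mul_eq_of_le_of_forall_succ (fun n => (hs n).2) hss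
  have hge : ∀ {m n}, m ≤ n → s n * s m = s n := fun {m n} h => by
    simpa [(hs _).1] using congrArg star (hle h)
  have htp n : t n * (s n - s (n + 1)) = t n := mul_eq_self_of_star_mul_self (hp n).2 (ht n)
  have hpt n : (s n - s (n + 1)) * star (t n) = star (t n) := by
    simpa only [star_mul, (hp n).1] using congrArg star (htp n)
  have hpp' : ∀ m n, m < n → (s m - s (m + 1)) * (s n - s (n + 1)) = 0 := fun m n h => by
    simp [sub_mul, mul_sub, hle h.le, hle (h.le.trans n.le_succ), hle (Nat.succ_le_of_lt h),
      hle ((Nat.succ_le_of_lt h).trans n.le_succ)]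
  have hpp : ∀ m n, m ≠ n → (s m - s (m + 1)) * (s n - s (n + 1)) = 0 := fun m n h => by
    rcases h.lt_or_gt with h | h
    · exact hpp' m n h
    · exact mul_eq_zero_comm_of_star (hp n).1 (hp m).1 (hpp' n m h)
  have htk n : t n * k = t n := by
    conv_lhs => rw [← htp n, mul_assoc, sub_mul, ← hs0, hge n.zero_le, hge (n + 1).zero_le, htp]
  have hkt n : k * star (t n) = star (t n) := by
    simpa [← hs0, (hs 0).1] using congrArg star (htk n)
  obtain ⟨w, hw, hw1, hw2, hw3, hw4⟩ := hR.exists_sum_partialIsometry t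
    (fun n => by rw [ht, htp])
    (fun m n h => by rw [← htp m, ← hpt n, mul_assoc, mul_mul_eq_of_mul_eq (hpp m n h)]; simp)
    htt (fun m n => by rw [← htk m, ← hXt n, mul_assoc, mul_mul_eq_of_mul_eq hkX]; simp)
  have hXw : X * w = w := mul_eq_self_of_one_sub_mul_eq_zero <|
    (hw4 _).1 fun n => by simp [sub_mul, hXt]
  have hkw : k * star w = star w := mul_eq_self_of_one_sub_mul_eq_zero <|
    (hw3 _).1 fun n => by simp [sub_mul, hkt]
  refine ⟨w, ?_, hXw, fun n => by rw [← ht, hw1]⟩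
  have hwt n : star w * t n = s n - s (n + 1) := by
    have h1 := congrArg star (congrArg (star (t n) * ·) (hw2 n))
    simpa [ht, mul_mul_eq_of_mul_eq (ht n), (hp n).1, (hs _).1, mul_assoc, htp,
      mul_mul_eq_of_mul_eq (hpt n), ← mul_sub, hpt] using h1
  have hDt n : (k - star w * w) * (s n - s (n + 1)) = 0 := by
    have h1 : s n - s (n + 1) = star (t n) * t n := (ht n).symm
    rw [sub_mul, mul_assoc, h1, hw1, hwt, ← mul_assoc, hkt, h1, sub_self]
  have hDs n : (k - star w * w) * s n = k - star w * w := by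
    induction n with
    | zero =>
      have : w * k = w := by simpa [← hs0, (hs 0).1] using congrArg star hkw
      rw [hs0, sub_mul, mul_assoc, this, ← hs0, (hs 0).2]
    | succ n ih =>
      have := hDt n
      rw [mul_sub, ih, sub_eq_zero] at this
      exact this.symm
  have hD : star (k - star w * w) = k - star w * w := by simp [← hs0, (hs 0).1]
  have := hinf (k - star w * w) fun n => by
    simpa only [star_mul, hD, (hs n).1] using congrArg star (hDs n)
  exact (sub_eq_zero.1 this).symm

/-- If `k` is the supremum of the increasing sequence `k - s n` of projections each of which is
subequivalent to `X`, then `k` is subequivalent to `X`. -/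
theorem IsRickart.exists_of_antitone (hR : IsRickart A) (hfin : IsFiniteCStar A) {k X : A}
    {s : ℕ → A} (hs : ∀ n, IsProjection (s n)) (hs0 : s 0 = k)
    (hss : ∀ n, s n * s (n + 1) = s (n + 1)) (hinf : ∀ z, (∀ n, s n * z = z) → z = 0)
    (hX : IsProjection X) (hkX : k * X = 0)
    (hu : ∀ n, ∃ u, star u * u = k - s n ∧ X * u = u) :
    ∃ v : A, star v * v = k ∧ X * v = v := by
  have hle : ∀ {m n}, m ≤ n → s m * s n = s n := mul_eq_of_le_of_forall_succ (fun n => (hs n).2) hss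
  have hge : ∀ {m n}, m ≤ n → s n * s m = s n := fun {m n} h => by
    simpa [(hs _).1] using congrArg star (hle h)
  have hq n : IsProjection (k - s n) := hs0 ▸ (hs 0).sub (hs n) (hle n.zero_le)
  have hp n : IsProjection (s n - s (n + 1)) := (hs n).sub (hs _) (hss n)
  have step : ∀ n R, ∃ t, star R * R = k - s n ∧ X * R = R →
      star t * t = s n - s (n + 1) ∧ X * t = t ∧ star R * t = 0 := fun n R => by
    by_cases h : star R * R = k - s n ∧ X * R = R
    · obtain ⟨u, hu, hXu⟩ := hu (n + 1)
      obtain ⟨t, ht, hXt, hRt⟩ := hR.exists_cancel hfin (hq (n + 1)) (hq n) hX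
        (by simp [sub_mul, mul_sub, ← hs0, (hs 0).2, hle n.zero_le, hge (n + 1).zero_le,
              hge n.le_succ]) hu hXu h.1 h.2
      exact ⟨t, fun _ => ⟨by rw [ht]; abel, hXt, hRt⟩⟩
    · exact ⟨0, fun h' => absurd h' h⟩
  choose t ht using step
  let R : ℕ → A := fun n => Nat.rec 0 (fun n R => R + t n R) n
  have hR_succ n : R (n + 1) = R n + t n (R n) := rfl
  have inv : ∀ n, star (R n) * R n = k - s n ∧ X * R n = R n := fun n => by
    induction n with
    | zero => simp [R, hs0]
    | succ n ih =>
      obtain ⟨h1, h2, h3⟩ := ht n _ ih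
      have h4 : star (t n (R n)) * R n = 0 := by simpa using congrArg star h3
      rw [hR_succ]
      refine ⟨?_, by rw [mul_add, ih.2, h2]⟩
      rw [star_add, add_mul, mul_add, mul_add, h1, h3, h4, ih.1]
      abel
  have htp n : t n (R n) * (s n - s (n + 1)) = t n (R n) :=
    mul_eq_self_of_star_mul_self (hp n).2 (ht n _ (inv n)).1
  have hRi : ∀ i n, i ≤ n → R n * (k - s i) = R i := fun i n hin => by
    induction n, hin using Nat.le_induction with
    | base => exact mul_eq_self_of_star_mul_self (hq i).2 (inv i).1
    | succ n hin ih =>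
      rw [hR_succ, add_mul, ih, ← htp n, mul_assoc]
      simp [sub_mul, mul_sub, ← hs0, hge hin, hge (hin.trans n.le_succ), hge n.zero_le,
        hge (n + 1).zero_le]
  have hRt : ∀ i n, i ≤ n → star (R i) * t n (R n) = 0 := fun i n hin => by
    rw [← hRi i n hin, star_mul, mul_assoc, (ht n _ (inv n)).2.2, mul_zero]
  have htt : ∀ m n, m < n → star (t m (R m)) * t n (R n) = 0 := fun m n hmn => by
    have h := hRt (m + 1) n hmn
    rwa [hR_succ, star_add, add_mul, hRt m n hmn.le, zero_add] at h
  obtain ⟨v, hv, hXv, -⟩ := hR.exists_sum_of_antitone (t := fun n => t n (R n)) hs hs0 hss hinf hkX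
    (fun n => (ht n _ (inv n)).1) (fun n => (ht n _ (inv n)).2.1) fun m n hmn => by
      rcases hmn.lt_or_gt with h | h
      · exact htt m n h
      · simpa using congrArg star (htt n m h)
  exact ⟨v, hv, hXv⟩

theorem mul_mul_star_eq_zero_iff {a b k : A} (hk : k * k = k) (ha : star a * a = k)
    (hb : star b * b = k) (z : A) : z * (b * star a) = 0 ↔ z * b = 0 := by
  refine ⟨fun h => ?_, fun h => by rw [← mul_assoc, h, zero_mul]⟩
  have h1 := congrArg (· * a) h
  simpa only [mul_assoc, ha, mul_eq_self_of_star_mul_self hk hb, zero_mul] using h1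

/-- A finite Rickart C*-algebra contains no infinite sequence of orthogonal equivalent nonzero
projections. -/
theorem IsRickart.eq_zero_of_sequence (hR : IsRickart A) (hfin : IsFiniteCStar A) {k : A}
    (hk : k * k = k) {r : ℕ → A} (hr : ∀ n, star (r n) * r n = k)
    (hrr : ∀ m n, m ≠ n → star (r m) * r n = 0) : k = 0 := by
  have hrk n : r n * k = r n := mul_eq_self_of_star_mul_self hk (hr n)
  have key : ∀ g h : ℕ → ℕ, g.Injective → h.Injective → (∀ m n, g m ≠ h n) →
      ∃ w : A, w * (star w * w) = w ∧ (∀ z, (∀ n, z * r (g n) = 0) ↔ z * (star w * w) = 0) ∧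
        (∀ z, (∀ n, z * r (h n) = 0) ↔ z * (w * star w) = 0) := by
    intro g h hg hh hgh
    obtain ⟨w, hw, -, -, hw3, hw4⟩ := hR.exists_sum_partialIsometry
      (fun n => r (h n) * star (r (g n)))
      (fun n => by simp only [star_mul, star_star, mul_assoc, mul_mul_eq_of_mul_eq (hr _),
        mul_mul_eq_of_mul_eq (hrk _)])
      (fun m n hmn => by simp only [star_mul, star_star, mul_assoc,
        mul_mul_eq_of_mul_eq (hrr _ _ (hg.ne hmn)), zero_mul, mul_zero])
      (fun m n hmn => by simp only [star_mul, star_star, mul_assoc,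
        mul_mul_eq_of_mul_eq (hrr _ _ (hh.ne hmn)), zero_mul, mul_zero])
      (fun m n => by simp only [mul_assoc,
        mul_mul_eq_of_mul_eq (hrr _ _ (hgh m n)), zero_mul, mul_zero])
    refine ⟨w, hw, fun z => ?_, fun z => ?_⟩
    · have h1 := mul_self_star_eq_zero_iff (z := z) (a := star w)
      rw [star_star] at h1
      rw [h1, ← hw3]
      refine forall_congr' fun n => ?_
      rw [star_mul, star_star, mul_mul_star_eq_zero_iff hk (hr _) (hr _)]
    · rw [mul_self_star_eq_zero_iff, ← hw4]
      refine forall_congr' fun n => ?_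
      rw [mul_mul_star_eq_zero_iff hk (hr _) (hr _)]
  obtain ⟨v, hv, hv1, hv2⟩ := key (fun n => 2 * n) (fun n => 2 * n + 1)
    (fun m n h => by simpa using h) (fun m n h => by simpa using h) (fun m n => by omega)
  obtain ⟨w, hw, hw1, hw2⟩ := key (fun n => 2 * n + 1) (fun n => 2 * n + 2)
    (fun m n h => by simpa using h) (fun m n h => by simpa using h) (fun m n => by omega)
  have hvw : v * star v = star w * w := (isProjection_mul_star_self hv).eq_of_mul_eq_zero_iff
    (isProjection_star_mul_self hw) fun z => (hv2 z).symm.trans (hw1 z)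
  have hE := isProjection_star_mul_self hv
  have hEr n : star v * v * r (2 * n) = r (2 * n) := mul_eq_self_of_one_sub_mul_eq_zero <|
    (hv1 _).2 (by rw [sub_mul, hE.2, one_mul, sub_self]) n
  have hEw : (1 - star v * v) * w = 0 := mul_self_star_eq_zero_iff.1 <| (hw2 _).1 fun n => by
    rw [sub_mul, one_mul, sub_eq_zero]
    exact (hEr (n + 1)).symm
  have hwE : star w * (1 - star v * v) = 0 := by
    simpa only [star_mul, hE.one_sub.1, star_zero] using congrArg star hEw
  have hvE : v * (1 - star v * v) = 0 := by rw [mul_sub, hv, mul_one, sub_self]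
  have hEv : (1 - star v * v) * star v = 0 := by
    simpa only [star_mul, hE.one_sub.1, star_zero] using congrArg star hvE
  have h1 : star (w * v + (1 - star v * v)) * (w * v + (1 - star v * v)) = 1 := by
    rw [star_add, hE.one_sub.1, add_mul, mul_add, mul_add, hE.one_sub.2, star_mul]
    have e1 : star v * star w * (w * v) = star v * v := by
      rw [mul_assoc, ← mul_assoc (star w), ← hvw, mul_assoc, hv]
    rw [e1, mul_assoc _ (star w), hwE, ← mul_assoc _ w, hEw]
    simp
  have h2 := hfin.star_mul_self_eq_one (u := star (w * v + (1 - star v * v))) (by simpa using h1)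
  have h3 : (w * v + (1 - star v * v)) * star (w * v + (1 - star v * v)) =
      w * star w + (1 - star v * v) := by
    rw [star_add, hE.one_sub.1, add_mul, mul_add, mul_add, hE.one_sub.2, star_mul]
    have e1 : w * v * (star v * star w) = w * star w := by
      rw [mul_assoc, ← mul_assoc v, hvw, mul_assoc, star_mul_mul_star_self hw]
    rw [e1, mul_assoc w v, hvE, ← mul_assoc _ (star v), hEv]
    simp
  rw [star_star, h3] at h2
  have h4 : w * star w = star v * v := by
    rwa [← add_sub_assoc, sub_eq_iff_eq_add, add_comm, add_right_inj] at h2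
  have h5 : star (r 0) * (w * star w) = 0 := (hw2 _).1 fun n => hrr _ _ (by omega)
  have h6 : r 0 = 0 := by
    rw [← hEr 0, ← h4]
    simpa [mul_assoc] using congrArg star h5
  rw [← hr 0, h6, mul_zero]

/-- A sequence of projections decreasing to zero, all dominating `k` in the sense of Murray and von
Neumann and orthogonal to `k`. -/
structure IsVanishingTower (k : A) (T : ℕ → A) : Prop where
  isProjection : ∀ n, IsProjection (T n)
  mul_succ : ∀ n, T n * T (n + 1) = T (n + 1)
  eq_zero : ∀ z, (∀ n, T n * z = z) → z = 0
  mul_zero_eq : k * T 0 = 0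
  exists_sub : ∀ n, ∃ u, star u * u = k ∧ T n * u = u

theorem IsVanishingTower.exists_partialIsometry (hR : IsRickart A)
    {k : A} (hk : IsProjection k) {T : ℕ → A} (h : IsVanishingTower k T) :
    ∃ (r : A) (s : ℕ → A), star r * r = k ∧ T 0 * r = r ∧ (∀ n, IsProjection (s n)) ∧ s 0 = k ∧
      (∀ n, s n * s (n + 1) = s (n + 1)) ∧ (∀ z, (∀ n, s n * z = z) → z = 0) ∧
      ∀ n, T n * r = r * s n := by
  have hT := h.isProjection
  have hle : ∀ {m n}, m ≤ n → T m * T n = T n :=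
    mul_eq_of_le_of_forall_succ (fun n => (hT n).2) h.mul_succ
  have hge : ∀ {m n}, m ≤ n → T n * T m = T n := fun {m n} h => by
    simpa [(hT _).1] using congrArg star (hle h)
  obtain ⟨u, hu, hTu⟩ := h.exists_sub 0
  have huk : u * k = u := mul_eq_self_of_star_mul_self hk.2 hu
  have hku : k * star u = star u := by simpa [hk.1] using congrArg star huk
  have huT : star u * T 0 = star u := by simpa [(hT 0).1] using congrArg star hTu
  choose σ hσ hσ' using fun n => hR.exists_leftProjection (star u * (1 - T n))
  have hσ0 : σ 0 = 0 := by simpa using (hσ' 0 1).1 (by rw [one_mul, mul_sub, mul_one, huT, sub_self])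
  have hkσ n : k * σ n = σ n := mul_eq_self_of_one_sub_mul_eq_zero <|
    (hσ' n _).1 (by rw [← mul_assoc, sub_mul, hku, one_mul, sub_self, zero_mul])
  have hσk n : σ n * k = σ n := by simpa [hk.1, (hσ n).1] using congrArg star (hkσ n)
  have hσu n : σ n * (star u * (1 - T n)) = star u * (1 - T n) :=
    mul_eq_self_of_left_annihilator (hσ n) fun z => (hσ' n z).2
  have hff n : (1 - T (n + 1)) * (1 - T n) = 1 - T n := by
    simp [sub_mul, mul_sub, hge n.le_succ]
  have hσσ n : σ (n + 1) * σ n = σ n := mul_eq_self_of_one_sub_mul_eq_zero <| (hσ' n _).1 <| by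
    rw [← hff, ← mul_assoc (star u), ← mul_assoc, sub_mul 1 (σ (n + 1)), hσu, one_mul, sub_self,
      zero_mul]
  have hσσ' n : σ n * σ (n + 1) = σ n := by
    simpa [(hσ n).1, (hσ (n + 1)).1] using congrArg star (hσσ n)
  have hs n : IsProjection (k - σ n) := hk.sub (hσ n) (hkσ n)
  have hp n : IsProjection (σ (n + 1) - σ n) := (hσ _).sub (hσ n) (hσσ n)
  have hpp n : k - σ n - (k - σ (n + 1)) = σ (n + 1) - σ n := by abel
  have hpk n : (σ (n + 1) - σ n) * k = σ (n + 1) - σ n := by rw [sub_mul, hσk, hσk]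
  have hinf : ∀ z, (∀ n, (k - σ n) * z = z) → z = 0 := fun z hz => by
    have h0 : k * z = z := by simpa [hσ0] using hz 0
    have h1 : u * z = 0 := h.eq_zero _ fun n => by
      have h2 : σ n * z = 0 := by simpa [sub_mul, h0] using hz n
      have h3 : star z * (star u * (1 - T n)) = 0 :=
        (hσ' n _).2 (by simpa [(hσ n).1] using congrArg star h2)
      have h4 : (1 - T n) * (u * z) = 0 := by simpa [(hT n).1, mul_assoc] using congrArg star h3
      rw [sub_mul, one_mul, sub_eq_zero] at h4
      exact h4.symm
    rw [← h0, ← hu, mul_assoc, h1, mul_zero]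
  have hss n : (k - σ n) * (k - σ (n + 1)) = k - σ (n + 1) := by
    simp [sub_mul, mul_sub, hk.2, hkσ, hσk, hσσ']
  have hkT n : k * T n = 0 := by
    rw [← hle n.zero_le, ← mul_assoc, h.mul_zero_eq, zero_mul]
  have hku0 : k * u = 0 := by rw [← hTu, ← mul_assoc, hkT, zero_mul]
  have hpol : ∀ n, ∃ t, star t * t = σ (n + 1) - σ n ∧ (T n - T (n + 1)) * t = t := fun n => by
    have ha : (1 - T (n + 1)) * (u * (σ (n + 1) - σ n)) *
        ((1 - T (n + 1)) * (u * (σ (n + 1) - σ n))) = 0 := by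
      have : (σ (n + 1) - σ n) * ((1 - T (n + 1)) * u) = 0 := by
        rw [← hpk, mul_assoc, ← mul_assoc k, mul_sub, hkT, sub_zero, mul_one, hku0, mul_zero]
      rw [mul_assoc, mul_assoc u, mul_mul_mul_eq_of_mul_mul_eq this]
      simp
    obtain ⟨t, ht, ht1, ht2⟩ := hR.exists_polar_of_mul_self_eq_zero ha
    refine ⟨t, (isProjection_star_mul_self ht).eq_of_mul_eq_zero_iff (hp n) fun z => ?_, ?_⟩
    · have h1 := mul_self_star_eq_zero_iff (z := z) (a := star t)
      rw [star_star] at h1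
      rw [h1, ← ht2, star_mul, star_mul, (hp n).1, (hT _).one_sub.1, mul_assoc, ← mul_assoc z, hσ',
        mul_assoc, sub_mul, (hσ _).2, hσσ']
    · refine mul_eq_self_of_one_sub_mul_eq_zero ((ht1 _).1 ?_)
      have h1 : (σ (n + 1) - σ n) * (star u * (1 - T n)) = 0 :=
        (hσ' n _).2 (by rw [sub_mul, hσσ, (hσ n).2, sub_self])
      have h2 : (1 - T n) * (u * (σ (n + 1) - σ n)) = 0 := by
        simpa [(hT n).1, (hσ _).1, mul_assoc] using congrArg star h1
      have h3 : (1 - (T n - T (n + 1))) * (1 - T (n + 1)) = 1 - T n := by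
        simp only [sub_mul, mul_sub, one_mul, mul_one, (hT _).2, hle n.le_succ]
        abel
      rw [← mul_assoc, h3, h2]
  choose t ht hht using hpol
  have hTt : ∀ n m, n ≤ m → T n * t m = t m := fun n m hnm => by
    rw [← hht, ← mul_assoc, mul_sub, hle hnm, hle (hnm.trans m.le_succ)]
  have hTt0 : ∀ n m, m < n → T n * t m = 0 := fun n m hnm => by
    rw [← hht, ← mul_assoc, mul_sub, hge hnm.le, hge hnm, sub_self, zero_mul]
  have htt : ∀ m n, m < n → star (t m) * t n = 0 := fun m n hmn => by
    rw [← hTt n n le_rfl, ← mul_assoc]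
    have : star (t m) * T n = 0 := by
      simpa [(hT n).1] using congrArg star (hTt0 n m hmn)
    rw [this, zero_mul]
  obtain ⟨r, hr, hTr, hrt⟩ := hR.exists_sum_of_antitone (t := t) hs (by rw [hσ0, sub_zero]) hss
    hinf (hkT 0) (fun n => by rw [ht, hpp]) (fun n => hTt 0 n n.zero_le) fun m n hmn => by
      rcases hmn.lt_or_gt with h | h
      · exact htt m n h
      · simpa using congrArg star (htt n m h)
  refine ⟨r, fun n => k - σ n, hr, hTr, hs, by simp only [hσ0, sub_zero], hss, hinf, fun n => ?_⟩
  have hrk : r * k = r := mul_eq_self_of_star_mul_self hk.2 hr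
  simp only [hpp] at hrt
  have hσle : ∀ {m n}, m ≤ n → σ n * σ m = σ m := fun {m n} hmn => by
    induction n, hmn using Nat.le_induction with
    | base => exact (hσ m).2
    | succ n _ ih => rw [← ih, ← mul_assoc, hσσ]
  have hσge : ∀ {m n}, m ≤ n → σ m * σ n = σ m := fun {m n} h => by
    simpa [(hσ _).1] using congrArg star (hσle h)
  have h1 : ∀ m ≤ n, T n * (r * σ m) = 0 := fun m hm => by
    induction m with
    | zero => simp [hσ0]
    | succ m ih =>
      have h2 := congrArg (T n * ·) (hrt m)
      simp only [mul_sub, ih (Nat.le_of_succ_le hm), hTt0 n m hm, sub_zero] at h2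
      exact h2
  have h2 : ∀ m, (1 - T n) * (r * (k - σ n)) * σ m = 0 := fun m => by
    induction m with
    | zero => rw [hσ0, mul_zero]
    | succ m ih =>
      have h3 : (1 - T n) * (r * (k - σ n)) * (σ (m + 1) - σ m) = 0 := by
        rcases le_or_gt n m with hnm | hnm
        · have h4 : (k - σ n) * (σ (m + 1) - σ m) = σ (m + 1) - σ m := by
            simp [sub_mul, mul_sub, hkσ, hσge hnm, hσge (hnm.trans m.le_succ)]
          rw [mul_assoc, mul_assoc, h4, hrt, sub_mul, hTt n m hnm, one_mul, sub_self]
        · have h4 : (k - σ n) * (σ (m + 1) - σ m) = 0 := by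
            simp [sub_mul, mul_sub, hkσ, hσle hnm.le, hσle (Nat.succ_le_of_lt hnm)]
          rw [mul_assoc, mul_assoc, h4, mul_zero, mul_zero]
      rwa [mul_sub, ih, sub_zero] at h3
  have h3 : star ((1 - T n) * (r * (k - σ n))) = 0 := hinf _ fun m => by
    have h4 : (1 - T n) * (r * (k - σ n)) * (k - σ m) = (1 - T n) * (r * (k - σ n)) := by
      rw [mul_sub, h2, sub_zero, mul_assoc, mul_assoc, sub_mul k, hk.2, hσk]
    simpa only [star_mul, (hs m).1] using congrArg star h4
  rw [star_eq_zero, sub_mul, one_mul, sub_eq_zero] at h3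
  rw [h3, mul_sub, mul_sub, hrk, h1 n le_rfl, sub_zero]

theorem IsVanishingTower.exists_next (hR : IsRickart A) (hfin : IsFiniteCStar A)
    {k : A} (hk : IsProjection k) {T : ℕ → A} (h : IsVanishingTower k T) :
    ∃ (r : A) (T' : ℕ → A), star r * r = k ∧ T 0 * r = r ∧ IsVanishingTower k T' ∧
      T 0 * T' 0 = T' 0 ∧ star r * T' 0 = 0 := by
  obtain ⟨r, s, hr, hTr0, hs, hs0, hss, hinf, hTr⟩ := h.exists_partialIsometry hR hk
  have hT := h.isProjection
  have hle : ∀ {m n}, m ≤ n → T m * T n = T n :=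
    mul_eq_of_le_of_forall_succ (fun n => (hT n).2) h.mul_succ
  have hsle : ∀ {m n}, m ≤ n → s m * s n = s n := mul_eq_of_le_of_forall_succ (fun n => (hs n).2) hss
  have hsge : ∀ {m n}, m ≤ n → s n * s m = s n := fun {m n} h => by
    simpa [(hs _).1] using congrArg star (hsle h)
  have hks n : k * s n = s n := hs0 ▸ hsle n.zero_le
  have hsk n : s n * k = s n := hs0 ▸ hsge n.zero_le
  have hrk : r * k = r := mul_eq_self_of_star_mul_self hk.2 hr
  have hkr : k * star r = star r := by simpa [hk.1] using congrArg star hrk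
  have hrT n : star r * T n = s n * star r := by
    simpa [(hT n).1, (hs n).1] using congrArg star (hTr n)
  have hT1 n : T n * (r * (s n * star r)) = r * (s n * star r) := by
    rw [← mul_assoc, hTr, mul_assoc, mul_mul_eq_of_mul_eq (hs n).2]
  have hTT n : T n * (T n - r * (s n * star r)) = T n - r * (s n * star r) := by
    rw [mul_sub, (hT n).2, hT1]
  refine ⟨r, fun n => T n - r * (s n * star r), hr, hTr0, ⟨fun n => ?_, fun n => ?_, fun z hz => ?_,
    ?_, fun n => ?_⟩, hTT 0, ?_⟩
  · refine (hT n).sub ⟨by simp [(hs n).1, mul_assoc], ?_⟩ (hT1 n)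
    simp only [mul_assoc, mul_mul_eq_of_mul_eq hr, mul_mul_eq_of_mul_eq (hks n),
      mul_mul_eq_of_mul_eq (hs n).2]
  · simp only [sub_mul, mul_sub, mul_assoc, h.mul_succ, hrT, mul_mul_eq_of_mul_eq hr,
      mul_mul_eq_of_mul_eq (hTr n), mul_mul_eq_of_mul_eq (hks _), mul_mul_eq_of_mul_eq (hss _)]
    abel
  · exact h.eq_zero z fun n => by rw [← hz n, ← mul_assoc, hTT]
  · rw [← hTT 0, ← mul_assoc, h.mul_zero_eq, zero_mul]
  · refine hR.exists_of_antitone hfin hs hs0 hss hinf ?_ ?_ fun m => ?_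
    · refine (hT n).sub ⟨by simp [(hs n).1, mul_assoc], ?_⟩ (hT1 n)
      simp only [mul_assoc, mul_mul_eq_of_mul_eq hr, mul_mul_eq_of_mul_eq (hks n),
        mul_mul_eq_of_mul_eq (hs n).2]
    · rw [← hTT n, ← mul_assoc, ← hle n.zero_le, ← mul_assoc, h.mul_zero_eq, zero_mul, zero_mul]
    · obtain ⟨u, hu, hTu⟩ := h.exists_sub (max m n)
      obtain ⟨t, ht, hTt, hrt⟩ := hR.exists_cancel hfin (r := r * s (max m n)) hk (hs _) (hT _)
        (hks (max m n)) hu hTu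
        (by simp only [star_mul, mul_assoc, mul_mul_eq_of_mul_eq hr, (hs _).1, (hs _).2, hks])
        (by rw [← mul_assoc, hTr, mul_assoc, (hs _).2])
      have hrt0 : star r * t = 0 := by
        rw [star_mul, (hs _).1, ← hrT, mul_assoc, hTt] at hrt
        exact hrt
      refine ⟨t * (k - s m), ?_, ?_⟩
      · rw [star_mul, mul_assoc, mul_mul_eq_of_mul_eq ht]
        simp only [star_sub, hk.1, (hs _).1, sub_mul, mul_sub, hk.2, (hs _).2, hks, hsk, hsge
          (le_max_left m n), hsle (le_max_left m n)]
        abel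
      · rw [← mul_assoc, sub_mul, mul_assoc r, mul_assoc (s n), hrt0, mul_zero, mul_zero, sub_zero,
          ← hTt, ← mul_assoc, hle (le_max_right m n)]
  · simp only
    rw [mul_sub, hrT, mul_mul_eq_of_mul_eq hr, mul_mul_eq_of_mul_eq (hks 0), sub_self]

theorem IsVanishingTower.eq_zero_of_isProjection (hR : IsRickart A) (hfin : IsFiniteCStar A)
    {k : A} (hk : IsProjection k) {T : ℕ → A} (h : IsVanishingTower k T) : k = 0 := by
  have step : ∀ T : ℕ → A, ∃ (r : A) (T' : ℕ → A), IsVanishingTower k T → star r * r = k ∧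
      T 0 * r = r ∧ IsVanishingTower k T' ∧ T 0 * T' 0 = T' 0 ∧ star r * T' 0 = 0 := fun T => by
    by_cases hT : IsVanishingTower k T
    · obtain ⟨r, T', h⟩ := hT.exists_next hR hfin hk
      exact ⟨r, T', fun _ => h⟩
    · exact ⟨0, 0, fun h => absurd h hT⟩
  choose r next hnext using step
  let S : ℕ → ℕ → A := fun n => Nat.rec T (fun _ => next) n
  have hS n : IsVanishingTower k (S n) := by
    induction n with
    | zero => exact h
    | succ n ih => exact (hnext _ ih).2.2.1
  have hle : ∀ {m n}, m ≤ n → S m 0 * S n 0 = S n 0 :=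
    mul_eq_of_le_of_forall_succ (s := fun n => S n 0) (fun n => ((hS n).isProjection 0).2)
      fun n => (hnext _ (hS n)).2.2.2.1
  have hlt : ∀ m n, m < n → star (r (S m)) * r (S n) = 0 := fun m n hmn => by
    rw [← (hnext _ (hS n)).2.1, ← hle (Nat.succ_le_of_lt hmn), ← mul_assoc, ← mul_assoc,
      (hnext _ (hS m)).2.2.2.2, zero_mul, zero_mul]
  refine hR.eq_zero_of_sequence hfin hk.2 (r := fun n => r (S n)) (fun n => (hnext _ (hS n)).1)
    fun m n hmn => ?_
  rcases hmn.lt_or_gt with h | h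
  · exact hlt m n h
  · simpa using congrArg star (hlt n m h)

/-- In a finite Rickart C*-algebra, a projection which is subequivalent to the complement of every
term of a sequence of projections increasing to the unit vanishes. -/
theorem IsRickart.eq_zero_of_forall_subequivalent (hR : IsRickart A) (hfin : IsFiniteCStar A)
    {f : ℕ → A} (hf : ∀ n, IsProjection (f n)) (hff : ∀ n, f (n + 1) * f n = f n)
    (hsup : ∀ z, (∀ n, z * f n = 0) → z = 0) {P : A} (hP : IsProjection P)
    (hu : ∀ n, ∃ u, star u * u = P ∧ f n * u = 0) : P = 0 := by
  have hff' : ∀ n, f n * f (n + 1) = f n := fun n => by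
    simpa [(hf _).1] using congrArg star (hff n)
  have hle : ∀ {m n}, m ≤ n → f m * f n = f m := fun {m n} hmn => by
    induction n, hmn using Nat.le_induction with
    | base => exact (hf m).2
    | succ n _ ih => rw [← ih, mul_assoc, hff']
  refine hsup P fun n => mul_eq_zero_comm_of_star (hf n).1 hP.1 ?_
  obtain ⟨v, hv, hvP, hfv, h0⟩ := hR.exists_partialIsometry_of_projections hP (hf n)
  have hvf : star v * f n = star v := by simpa [(hf n).1] using congrArg star hfv
  have hk : v * star v = 0 := by
    refine IsVanishingTower.eq_zero_of_isProjection hR hfin (isProjection_mul_star_self hv)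
      (T := fun m => 1 - f (m + n)) ⟨fun m => (hf _).one_sub, fun m => ?_, fun z hz => ?_, ?_,
        fun m => ?_⟩
    · have : f (m + n) * f (m + 1 + n) = f (m + n) := by rw [add_right_comm]; exact hff' _
      simp [sub_mul, mul_sub, this]
    · refine star_eq_zero.1 (hsup _ fun m => ?_)
      have h1 : f (m + n) * z = 0 := by simpa [sub_mul] using hz m
      have h2 : f m * z = 0 := by rw [← hle (m.le_add_right n), mul_assoc, h1, mul_zero]
      simpa [(hf m).1] using congrArg star h2
    · simp [mul_sub, mul_assoc, hvf]
    · obtain ⟨u, hu, hfu⟩ := hu (m + n)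
      refine ⟨u * star v, ?_, by simp [sub_mul, ← mul_assoc, hfu]⟩
      rw [star_mul, star_star, mul_assoc, mul_mul_eq_of_mul_eq hu, ← mul_assoc, hvP]
  have hv0 : v = 0 := (CStarRing.mul_star_self_eq_zero_iff v).1 hk
  simpa [hv0] using h0

/-- In a finite Rickart C*-algebra, an element with zero left annihilator has zero right
annihilator. -/
theorem IsRickart.eq_zero_of_mul_eq_zero (hR : IsRickart A) (hfin : IsFiniteCStar A) {x P : A}
    (hx : ∀ z, z * x = 0 → z = 0) (hP : IsProjection P) (hxP : x * P = 0) : P = 0 := by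
  let k : A := x * star x
  have hk : IsSelfAdjoint k := by simp [IsSelfAdjoint, k]
  have hk0 : ∀ t ∈ spectrum ℝ k, 0 ≤ t := by
    simpa [k] using spectrum_star_mul_self_nonneg (b := star x)
  let ε : ℕ → ℝ := fun n => (1 / 2) ^ n
  have hε n : 0 < ε n := by positivity
  have hε' n : ε n = 2 * ε (n + 1) := by simp only [ε, pow_succ]; ring
  let φ : ℕ → A := fun n => cfc (fun t : ℝ => max (t - ε n) 0) k
  let ψ : ℕ → A := fun n => cfc (fun t : ℝ => (√(max t (ε n)))⁻¹) k
  have hψc n : Continuous fun t : ℝ => (√(max t (ε n)))⁻¹ :=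
    (by fun_prop : Continuous fun t : ℝ => √(max t (ε n))).inv₀ fun t =>
      (Real.sqrt_pos.2 ((hε n).trans_le (le_max_right _ _))).ne'
  have hψc' n : Continuous fun t : ℝ => t * (√(max t (ε n)))⁻¹ := continuous_id'.mul (hψc n)
  have hψc'' n : Continuous fun t : ℝ => (√(max t (ε n)))⁻¹ * (t * (√(max t (ε n)))⁻¹) :=
    (hψc n).mul (hψc' n)
  have hφc n : Continuous fun t : ℝ => max (t - ε n) 0 := by fun_prop
  have hψ n : star (ψ n) = ψ n := (cfc_predicate (fun t : ℝ => (√(max t (ε n)))⁻¹) k).star_eq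
  choose f hf hfφ using fun n => hR.exists_leftProjection (φ n)
  have hψφ n : (1 - ψ n * (k * ψ n)) * φ n = 0 := by
    have h1 : ψ n * (k * ψ n) =
        cfc (fun t : ℝ => (√(max t (ε n)))⁻¹ * (t * (√(max t (ε n)))⁻¹)) k := by
      rw [cfc_mul (fun t : ℝ => (√(max t (ε n)))⁻¹) (fun t : ℝ => t * (√(max t (ε n)))⁻¹) k
        (hψc n).continuousOn (hψc' n).continuousOn,
        cfc_mul (fun t : ℝ => t) (fun t : ℝ => (√(max t (ε n)))⁻¹) k
        continuous_id'.continuousOn (hψc n).continuousOn, cfc_id' ℝ k]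
    have h2 : ψ n * (k * ψ n) * φ n = φ n := by
      rw [h1, ← cfc_mul (fun t : ℝ => (√(max t (ε n)))⁻¹ * (t * (√(max t (ε n)))⁻¹))
        (fun t : ℝ => max (t - ε n) 0) k (hψc'' n).continuousOn (hφc n).continuousOn]
      refine cfc_congr fun t _ => ?_
      rcases le_total t (ε n) with ht | ht
      · simp [ht]
      · have h3 : 0 < √t := Real.sqrt_pos.2 ((hε n).trans_le ht)
        have h4 : √t * √t = t := Real.mul_self_sqrt ((hε n).le.trans ht)
        have h5 : (√t)⁻¹ * (t * (√t)⁻¹) = 1 := by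
          field_simp
          nlinarith
        simp only [max_eq_left ht, h5, one_mul]
    rw [sub_mul, h2, one_mul, sub_self]
  have hψf n : ψ n * (k * ψ n) * f n = f n :=
    mul_eq_self_of_one_sub_mul_eq_zero ((hfφ n _).1 (hψφ n))
  have hfφ' n : f n * φ n = φ n := mul_eq_self_of_left_annihilator (hf n) fun z => (hfφ n z).2
  have hff n : f (n + 1) * f n = f n := by
    refine mul_eq_self_of_one_sub_mul_eq_zero ((hfφ n _).1 ?_)
    have h1 : φ n = φ (n + 1) *
        cfc (fun t : ℝ => max (t - ε n) 0 * (max (t - ε (n + 1)) (ε (n + 1)))⁻¹) k := by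
      have hc : Continuous fun t : ℝ => (max (t - ε (n + 1)) (ε (n + 1)))⁻¹ :=
        (by fun_prop : Continuous fun t : ℝ => max (t - ε (n + 1)) (ε (n + 1))).inv₀ fun t =>
          ((hε _).trans_le (le_max_right _ _)).ne'
      have hc' : Continuous fun t : ℝ => max (t - ε n) 0 * (max (t - ε (n + 1)) (ε (n + 1)))⁻¹ :=
        (hφc n).mul hc
      rw [← cfc_mul (fun t : ℝ => max (t - ε (n + 1)) 0)
        (fun t : ℝ => max (t - ε n) 0 * (max (t - ε (n + 1)) (ε (n + 1)))⁻¹) k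
        (hφc _).continuousOn hc'.continuousOn]
      refine cfc_congr fun t _ => ?_
      rcases le_total t (ε n) with ht | ht
      · simp [ht]
      · have h2 := hε' n
        have h3 := hε (n + 1)
        have h4 : 0 < t - ε (n + 1) := by linarith
        simp only [max_eq_left h4.le, max_eq_left (show ε (n + 1) ≤ t - ε (n + 1) by linarith)]
        field_simp
    rw [h1, ← mul_assoc, sub_mul, hfφ', one_mul, sub_self, zero_mul]
  have hsup : ∀ z, (∀ n, z * f n = 0) → z = 0 := fun z hz => by
    refine hx z (mul_self_star_eq_zero_iff.1 ?_)
    have h1 : ∀ n, ‖z * k‖ ≤ ‖z‖ * ε n := fun n => by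
      have h2 : z * k = z * (k - φ n) := by rw [mul_sub, (hfφ n z).2 (hz n), sub_zero]
      have h3 : k - φ n = cfc (fun t : ℝ => t - max (t - ε n) 0) k := by
        rw [cfc_sub _ _ k, cfc_id' ℝ k]
      rw [h2]
      refine (norm_mul_le _ _).trans (mul_le_mul_of_nonneg_left ?_ (norm_nonneg _))
      rw [h3]
      refine norm_cfc_le (hε n).le fun t ht => ?_
      have h4 := hk0 t ht
      have h5 := hε n
      rw [Real.norm_eq_abs, abs_le]
      rcases le_total t (ε n) with h | h
      · rw [max_eq_right (by linarith)]
        constructor <;> linarith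
      · rw [max_eq_left (by linarith)]
        constructor <;> linarith
    have h6 : Filter.Tendsto (fun n => ‖z‖ * ε n) Filter.atTop (nhds 0) := by
      have := (tendsto_pow_atTop_nhds_zero_of_lt_one (r := (1 / 2 : ℝ)) (by norm_num)
        (by norm_num)).const_mul ‖z‖
      rwa [mul_zero] at this
    exact norm_le_zero_iff.1 (ge_of_tendsto' h6 h1)
  refine hR.eq_zero_of_forall_subequivalent hfin hf hff hsup hP fun n => ?_
  have hw : f n * ψ n * x * star (f n * ψ n * x) = f n := by
    simp only [star_mul, hψ, (hf n).1]
    calc f n * ψ n * x * (star x * (ψ n * f n)) = f n * (ψ n * (k * ψ n) * f n) := by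
          simp only [k, mul_assoc]
      _ = f n := by rw [hψf, (hf n).2]
  obtain ⟨v, hv, hv'⟩ := hR.exists_unitary_extension hfin (w := f n * ψ n * x)
    (by rw [← mul_assoc, hw]; simp only [← mul_assoc, (hf n).2])
  refine ⟨v * P, ?_, ?_⟩
  · rw [star_mul, mul_assoc, mul_mul_eq_of_mul_eq hv, sub_mul, mul_assoc, mul_assoc _ x, hxP]
    simp [hP.1, hP.2]
  · rw [← mul_assoc, (mul_self_star_eq_zero_iff (z := f n) (a := v)).1, zero_mul]
    rw [hv', hw, mul_sub, (hf n).2, mul_one, sub_self]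

/-- In a finite Rickart C*-algebra the left and the right annihilator projection of an element are
equivalent. -/
theorem IsRickart.exists_partialIsometry_annihilator (hR : IsRickart A) (hfin : IsFiniteCStar A)
    (x : A) :
    ∃ e : A, e * (star e * e) = e ∧ (∀ z, z * x = 0 ↔ z * (e * star e) = z) ∧
      ∀ z, x * z = 0 ↔ star e * e * z = z := by
  obtain ⟨p, hp, hp'⟩ := hR.exists_leftProjection (star x)
  obtain ⟨q, hq, hq'⟩ := hR.exists_leftProjection x
  obtain ⟨P, hP, rfl⟩ : ∃ P, IsProjection P ∧ p = 1 - P := ⟨1 - p, hp.one_sub, by simp⟩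
  obtain ⟨Q, hQ, rfl⟩ : ∃ Q, IsProjection Q ∧ q = 1 - Q := ⟨1 - q, hq.one_sub, by simp⟩
  have hxz : ∀ z, x * z = 0 ↔ P * z = z := fun z => by
    have h1 : x * z = 0 ↔ star z * star x = 0 := by rw [← star_mul, star_eq_zero]
    rw [h1, hp', ← hp.1, ← star_mul, star_eq_zero, sub_mul, one_mul, sub_eq_zero, eq_comm]
  have hzx : ∀ z, z * x = 0 ↔ z * Q = z := fun z => by
    rw [hq', mul_sub, mul_one, sub_eq_zero, eq_comm]
  have hxP : x * P = 0 := (hxz P).2 hP.2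
  have hQx : Q * x = 0 := (hzx Q).2 hQ.2
  obtain ⟨v, C, hv, hvP, hQv, hC, hCx, hCv, h1, h2⟩ := hR.exists_comparison (fun _ => x) hP hQ
  replace hCx := hCx 0
  have hPv : P * star v = star v := by simpa [hP.1] using congrArg star hvP
  have hvQ : star v * Q = star v := by simpa [hQ.1] using congrArg star hQv
  have hxv : x * star v = 0 := (hxz _).2 hPv
  have hvx : star v * x = 0 := (hzx _).2 hvQ
  have hg : C * (x + v) = (x + v) * C := by rw [mul_add, add_mul, hCx, hCv]
  have hPr := hP.sub (isProjection_star_mul_self hv) (by rw [← mul_assoc, hPv])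
  have hQr := hQ.sub (isProjection_mul_star_self hv) (by rw [← mul_assoc, hQv])
  have hP0 : P - star v * v = 0 := by
    refine hR.eq_zero_of_mul_eq_zero hfin (x := C * (x + v) + (1 - C)) (fun z hz => ?_) hPr ?_
    · have h3 : z * (1 - C) = 0 := by
        have h4 := congrArg (· * (1 - C)) hz
        simp only [zero_mul, hg, mul_assoc, add_mul (_ * C), hC.one_sub.2] at h4
        simpa [mul_sub, hC.2] using h4
      have hzC : z * C = z := by rwa [mul_sub, mul_one, sub_eq_zero, eq_comm] at h3
      have h4 : z * (x + v) = 0 := by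
        rwa [mul_add z, h3, add_zero, ← mul_assoc, hzC] at hz
      have h5 : z * v = 0 := mul_self_star_eq_zero_iff.1 <| by
        have := congrArg (· * star v) h4
        simpa [mul_add, add_mul, mul_assoc, hxv] using this
      have h6 : z * Q = z := (hzx z).1 (by rwa [mul_add, h5, add_zero] at h4)
      rw [← h6]
      have h7 : z * C * (Q - v * star v) = 0 := by rw [mul_assoc, h2, mul_zero]
      rwa [hzC, mul_sub, ← mul_assoc, h5, zero_mul, sub_zero] at h7
    · have h3 : x * (P - star v * v) = 0 := by
        rw [mul_sub, hxP, ← mul_assoc, hxv, zero_mul, sub_zero]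
      have h4 : v * (P - star v * v) = 0 := by rw [mul_sub, hvP, hv, sub_self]
      rw [add_mul, mul_assoc, add_mul x, h3, h4, sub_mul 1 C, h1]
      simp
  have hQC : (Q - v * star v) * C = 0 := mul_eq_zero_comm_of_star hC.1 hQr.1 h2
  rw [sub_eq_zero] at hP0
  have hQ0 : Q - v * star v = 0 := by
    refine hR.eq_zero_of_mul_eq_zero hfin (x := star ((1 - C) * (x + v) + C)) (fun z hz => ?_)
      hQr ?_
    · have hz' : ((1 - C) * (x + v) + C) * star z = 0 := by
        simpa only [star_mul, star_star, star_zero] using congrArg star hz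
      have h3 : C * star z = 0 := by
        have h4 : C * (((1 - C) * (x + v) + C) * star z) = 0 := by rw [hz', mul_zero]
        have h5 : C * (1 - C) = 0 := by rw [mul_sub, hC.2, mul_one, sub_self]
        rwa [← mul_assoc, mul_add C, hC.2, ← mul_assoc C, h5, zero_mul, zero_add] at h4
      have h4 : (x + v) * star z = 0 := by
        rw [add_mul _ C, h3, add_zero, sub_mul, one_mul, hg, sub_mul, mul_assoc (x + v) C, h3,
          mul_zero, sub_zero] at hz'
        exact hz'
      have h5 : v * star z = 0 := by
        have h6 := congrArg (star v * ·) h4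
        simp only [mul_add, add_mul, ← mul_assoc, hvx, zero_mul, zero_add, mul_zero] at h6
        refine eq_zero_of_star_mul_self ?_
        rw [star_mul, star_star, mul_assoc, ← mul_assoc (star v), h6, mul_zero]
      have h6 : P * star z = star z := (hxz _).1 (by rwa [add_mul, h5, add_zero] at h4)
      rw [← star_eq_zero, ← h6, hP0, mul_assoc, h5, mul_zero]
    · have h3 : (Q - v * star v) * x = 0 := by
        rw [sub_mul, hQx, mul_assoc, hvx, mul_zero, sub_zero]
      have h4 : (Q - v * star v) * v = 0 := by rw [sub_mul, hQv, mul_assoc, hv, sub_self]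
      have h5 : (Q - v * star v) * ((1 - C) * (x + v) + C) = 0 := by
        rw [mul_add _ _ C, hQC, ← mul_assoc, mul_sub _ 1 C, hQC, mul_one, sub_zero, mul_add, h3, h4]
        simp
      simpa only [star_mul, hQr.1, star_zero] using congrArg star h5
  rw [sub_eq_zero] at hQ0
  exact ⟨v, hv, fun z => by rw [hzx, hQ0], fun z => by rw [hxz, hP0]⟩

theorem mul_eq_zero_of_mul_star_mul_mul_eq_zero {x y : A} (h : x * star x * x * y = 0) :
    x * y = 0 := by
  have h1 : star x * x * y = 0 := eq_zero_of_star_mul_self <| by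
    simp only [star_mul, star_star, mul_assoc] at h ⊢
    rw [h, mul_zero, mul_zero]
  refine eq_zero_of_star_mul_self ?_
  rw [star_mul, mul_assoc, ← mul_assoc (star x), h1, mul_zero]

theorem innerIdealGen_subset_of_isClosed {x : A} {S : Set A} (hS : IsClosed S)
    (h : ∀ a, x * a * x ∈ S) : innerIdealGen x ⊆ S :=
  closure_minimal (by rintro _ ⟨a, rfl⟩; exact h a) hS

theorem mul_mul_mem_innerIdealGen (x a : A) : x * a * x ∈ innerIdealGen x :=
  subset_closure ⟨a, rfl⟩

theorem isClosed_peirce0 (e : A) : IsClosed (Peirce0 e) :=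
  (isClosed_eq (by fun_prop) continuous_const).inter (isClosed_eq (by fun_prop) continuous_const)

theorem isClosed_orthog (t : A) : IsClosed {s : A | Orthog s t} :=
  (isClosed_eq (by fun_prop) continuous_const).inter (isClosed_eq (by fun_prop) continuous_const)

theorem IsRickart.exists_peirce (hR : IsRickart A) (hfin : IsFiniteCStar A) (x : A) {J : Set A}
    (hJ : ∀ s ∈ innerIdealGen x, ∀ t ∈ J, Orthog s t) :
    ∃ e : A, IsPartialIsometry e ∧ J ⊆ Peirce2 e ∧ innerIdealGen x ⊆ Peirce0 e := by
  obtain ⟨e, he, hl, hr⟩ := hR.exists_partialIsometry_annihilator hfin x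
  have hee := isProjection_mul_star_self he
  have hee' := isProjection_star_mul_self he
  refine ⟨e, hee, fun t ht => ?_,
    innerIdealGen_subset_of_isClosed (isClosed_peirce0 e) fun a => ⟨?_, ?_⟩⟩
  · obtain ⟨h1, h2⟩ := hJ _ (mul_mul_mem_innerIdealGen x (star x)) t ht
    have h3 := (hr _).1 (mul_eq_zero_of_mul_star_mul_mul_eq_zero h1)
    have h4 : star x * t = 0 := mul_eq_zero_of_mul_star_mul_mul_eq_zero <| by
      simpa [mul_assoc] using congrArg star h2
    have h5 := (hl (star t)).1 (by simpa using congrArg star h4)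
    have h6 : t * (star e * e) = t := by
      simpa only [star_mul, star_star] using congrArg star h3
    have h7 : e * star e * t = t := by
      simpa only [star_mul, star_star] using congrArg star h5
    rw [Peirce2, Set.mem_ofPred_eq, h7, h6]
  · rw [← mul_assoc, ← mul_assoc, (hl _).2 hee.2, zero_mul, zero_mul]
  · rw [mul_assoc, (hr _).2 hee'.2, mul_zero]

/-- The annihilator of an element from both sides. -/
def twoSidedAnnihilator (k : A) : Submodule ℂ A where
  carrier := {y | k * y = 0 ∧ y * k = 0}
  zero_mem' := by simp
  add_mem' := by
    rintro a b ⟨h1, h2⟩ ⟨h3, h4⟩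
    exact ⟨by rw [mul_add, h1, h3, add_zero], by rw [add_mul, h2, h4, add_zero]⟩
  smul_mem' := by
    rintro c a ⟨h1, h2⟩
    exact ⟨by rw [mul_smul_comm, h1, smul_zero], by rw [smul_mul_assoc, h2, smul_zero]⟩

theorem isInnerIdeal_twoSidedAnnihilator (k : A) : IsInnerIdeal (twoSidedAnnihilator k) := by
  rintro x ⟨hx, -⟩ y ⟨-, hy⟩ a
  exact ⟨by rw [← mul_assoc, ← mul_assoc, hx, zero_mul, zero_mul], by rw [mul_assoc, hy, mul_zero]⟩

theorem isRickart_of_exists_peirce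
    (h : ∀ (x : A) (J : Submodule ℂ A), IsInnerIdeal J →
      (∀ s ∈ innerIdealGen x, ∀ t ∈ (J : Set A), Orthog s t) →
      ∃ e : A, IsPartialIsometry e ∧ (J : Set A) ⊆ Peirce2 e ∧ innerIdealGen x ⊆ Peirce0 e) :
    IsRickart A := by
  intro x
  obtain ⟨e, he, h2, h0⟩ := h (star x * x) (twoSidedAnnihilator (star x * x))
      (isInnerIdeal_twoSidedAnnihilator _) <| by
    rintro s hs t ⟨ht : star x * x * t = 0, ht' : t * (star x * x) = 0⟩
    refine innerIdealGen_subset_of_isClosed (isClosed_orthog t) (fun a => ?_) hs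
    have h3 : star x * x * star t = 0 := by simpa [mul_assoc] using congrArg star ht'
    have h4 : star t * (star x * x) = 0 := by simpa [mul_assoc] using congrArg star ht
    exact ⟨by rw [mul_assoc, h3, mul_zero], by
      rw [mul_assoc (star x * x) a, ← mul_assoc (star t), h4, zero_mul]⟩
  have hkk := (h0 (mul_mul_mem_innerIdealGen (star x * x) 1)).1
  rw [mul_one, ← mul_assoc] at hkk
  have hxp : x * (e * star e) = 0 := by
    have h3 : star (x * (e * star e)) * (x * (e * star e)) = 0 := by
      have h4 : (e * star e) * (star x * x) = 0 := by
        have := (mul_self_star_eq_zero_iff (z := e * star e) (a := star x * x)).1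
        rw [star_mul, star_star, ← mul_assoc] at this
        exact this hkk
      rw [star_mul, he.1, mul_assoc, ← mul_assoc (star x), ← mul_assoc, h4, zero_mul]
    exact eq_zero_of_star_mul_self h3
  refine ⟨e * star e, he, Set.ext fun y => ⟨fun hy => ⟨y, ?_⟩, ?_⟩⟩
  · have hy : x * y = 0 := hy
    have h3 : y * star y ∈ twoSidedAnnihilator (star x * x) := by
      refine ⟨by rw [mul_assoc, ← mul_assoc x, hy, zero_mul, mul_zero], ?_⟩
      have : star y * star x = 0 := by rw [← star_mul, hy, star_zero]
      rw [mul_assoc, ← mul_assoc (star y), this, zero_mul, mul_zero]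
    have h4 : e * star e * (y * star y) * (star e * e) = y * star y := h2 h3
    have h5 : (1 - e * star e) * (y * star y) = 0 := by
      have h6 := congrArg (e * star e * ·) h4
      simp only [← mul_assoc, he.2] at h4 h6
      rw [sub_mul, one_mul, sub_eq_zero, ← mul_assoc, ← h6, h4]
    exact (mul_eq_self_of_one_sub_mul_eq_zero (mul_self_star_eq_zero_iff.1 h5)).symm
  · rintro ⟨a, rfl⟩
    change x * (e * star e * a) = 0
    rw [← mul_assoc, hxp, zero_mul]

end CStar

/-- Let `A` be a finite unital C*-algebra. Then `A` is a Rickart C*-algebra if, and only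
if, for every `x ∈ A` and every inner ideal `J ⊆ A` orthogonal to the inner ideal `A(x)`
generated by `x`, there exists a partial isometry `e ∈ A` such that `J ⊆ A₂(e)` and
`A(x) ⊆ A₀(e)`. -/
theorem finite_rickart_iff_reversed_peirce_condition {A : Type*} [CStarAlgebra A]
    (hfin : IsFiniteCStar A) :
    IsRickart A ↔
      ∀ (x : A) (J : Submodule ℂ A), IsInnerIdeal J →
        (∀ s ∈ innerIdealGen x, ∀ t ∈ (J : Set A), Orthog s t) →
        ∃ e : A, IsPartialIsometry e ∧
          (J : Set A) ⊆ Peirce2 e ∧ innerIdealGen x ⊆ Peirce0 e :=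
  ⟨fun hR x _ _ hJ => hR.exists_peirce hfin x hJ, isRickart_of_exists_peirce⟩
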